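/- arXiv:1703.02939 — 4 statements merged into one kernel-verified Lean document; each statement's English description precedes it below -/
import Mathlib

section
/- For every prime power q and every integer k ≥ 2, set d = ∑_{i=0}^{k-1} q^i. Then there exists a finite family F of d-intervals that satisfies the (k,k) property and whose fractional covering number equals τ*(F) = q + 1/d. In particular the bound τ*(H) < (p·d)^{1/(p-1)} + 1 for families of d-intervals with the (p,p) property is asymptotically sharp. -/
/-- A `d`-interval: a nonempty subset of `ℝ` that is a union of at most `d`
closed bounded intervals. -/
def IsDInterval (d : ℕ) (s : Set ℝ) : Prop :=
  s.Nonempty ∧ ∃ P : Finset (ℝ × ℝ), P.card ≤ d ∧ s = ⋃ I ∈ P, Set.Icc I.1 I.2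

/-- A finite family `H` of sets satisfies the `(p,q)` property if among every
`p` distinct members of `H` some `q` have a point in common. -/
def HasPQProperty (H : Finset (Set ℝ)) (p q : ℕ) : Prop :=
  ∀ S ⊆ H, S.card = p → ∃ T ⊆ S, T.card = q ∧ (⋂ h ∈ T, (h : Set ℝ)).Nonempty

/-- The covering number `τ(H)`: the minimum cardinality of a finite set of
points meeting every member of `H`. -/
noncomputable def coverNum (H : Finset (Set ℝ)) : ℕ :=
  sInf { n : ℕ | ∃ C : Finset ℝ, C.card = n ∧ ∀ h ∈ H, ∃ x ∈ C, x ∈ h }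

/-- The fractional covering number `τ*(H)`: the infimum of total weights of
finitely supported fractional covers of `H`. -/
noncomputable def fracCoverNum (H : Finset (Set ℝ)) : ℝ :=
  sInf { t : ℝ | ∃ w : ℝ →₀ ℝ, (∀ x, 0 ≤ w x) ∧
    (∀ h ∈ H, 1 ≤ ∑ x ∈ w.support, Set.indicator h (fun y => w y) x) ∧
    t = ∑ x ∈ w.support, w x }

lemma Set.Finite.isDInterval {s : Set ℝ} (hs : s.Finite) (hne : s.Nonempty) {d : ℕ}
    (hd : s.ncard ≤ d) : IsDInterval d s := by
  classical
  refine ⟨hne, hs.toFinset.image fun x => (x, x), ?_, ?_⟩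
  · exact Finset.card_image_le.trans (by rwa [← Set.ncard_eq_toFinset_card s hs])
  · ext x
    simp

open Classical in
/-- The fractional covering number of the neighbourhoods of a symmetric `d`-regular relation,
placed on the real line. -/
lemma fracCoverNum_image_of_regular {α : Type*} [Fintype α] (e : α ↪ ℝ) (R : α → α → Prop)
    (hsymm : ∀ x y, R x y → R y x) {d : ℕ} (hd : 0 < d)
    (hR : ∀ a, (Finset.univ.filter fun x => R x a).card = d) :
    fracCoverNum (Finset.univ.image fun a => e '' {x | R x a}) =
      (Fintype.card α : ℝ) / d := by
  have hd' : (0 : ℝ) < d := by exact_mod_cast hd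
  have hmem (a x : α) : e x ∈ e '' {y | R y a} ↔ R x a := by simp
  refine IsLeast.csInf_eq ⟨?_, ?_⟩
  · have hsupp (x : ℝ) (hx : (if x ∈ Set.range e then (1 / d : ℝ) else 0) ≠ 0) :
        x ∈ Finset.univ.map e := by
      by_contra h
      exact hx (if_neg (by simpa using h))
    let w : ℝ →₀ ℝ := Finsupp.onFinset (Finset.univ.map e) _ hsupp
    have hw (x : ℝ) : w x = if x ∈ Set.range e then (1 / d : ℝ) else 0 := rfl
    have hwe (x : α) : w (e x) = 1 / d := by simp [hw]
    have hws : w.support = Finset.univ.map e := by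
      ext x
      simp [hw, hd.ne']
    refine ⟨w, fun x => ?_, ?_, ?_⟩
    · rw [hw]
      positivity
    · intro h hh
      obtain ⟨a, -, rfl⟩ := Finset.mem_image.1 hh
      rw [hws, Finset.sum_map]
      simp only [Set.indicator_apply, hmem, hwe]
      rw [← Finset.sum_filter, Finset.sum_const, hR, nsmul_eq_mul, mul_one_div_cancel hd'.ne']
    · rw [hws, Finset.sum_map]
      simp [hwe, div_eq_mul_inv]
  · rintro _ ⟨w, hw0, hw, rfl⟩
    rw [div_le_iff₀ hd']
    calc (Fintype.card α : ℝ) = ∑ _a : α, (1 : ℝ) := by simp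
      _ ≤ ∑ a : α, ∑ x ∈ w.support, Set.indicator (e '' {x | R x a}) (fun y => w y) x :=
          Finset.sum_le_sum fun a _ =>
            hw _ (Finset.mem_image_of_mem _ (Finset.mem_univ a))
      _ = ∑ x ∈ w.support, ∑ a : α, Set.indicator (e '' {x | R x a}) (fun y => w y) x :=
          Finset.sum_comm
      _ ≤ ∑ x ∈ w.support, w x * d := by
          refine Finset.sum_le_sum fun x _ => ?_
          simp only [Set.indicator_apply]
          rw [← Finset.sum_filter, Finset.sum_const, nsmul_eq_mul, mul_comm]
          refine mul_le_mul_of_nonneg_left ?_ (hw0 x)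
          norm_cast
          by_cases hx : x ∈ Set.range e
          · obtain ⟨b, rfl⟩ := hx
            rw [← hR b]
            refine Finset.card_le_card fun a ha => ?_
            simp only [Finset.mem_filter, Finset.mem_univ, true_and, hmem] at ha ⊢
            exact hsymm _ _ ha
          · rw [Finset.filter_false_of_mem]
            · simp
            · rintro a - ⟨y, -, rfl⟩
              exact hx ⟨y, rfl⟩
      _ = (∑ x ∈ w.support, w x) * d := (Finset.sum_mul _ _ _).symm

namespace Projectivization

open scoped LinearAlgebra.Projectivization

variable {K : Type*} [Field K] {n : ℕ}

/-- The number of points on a hyperplane of a finite projective space. -/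
lemma ncard_orthogonal [Finite K] (a : ℙ K (Fin (n + 1) → K)) :
    {x | orthogonal x a}.ncard = ∑ i ∈ Finset.range n, Nat.card K ^ i := by
  induction a using ind with | h v hv =>
  let f : Module.Dual K (Fin (n + 1) → K) := dotProductBilin K K v
  have hf : f ≠ 0 := fun h => hv (dotProduct_eq_zero _ fun w => LinearMap.congr_fun h w)
  have hrank : Module.finrank K (LinearMap.ker f) = n := by
    have := Module.Dual.finrank_ker_add_one_of_ne_zero hf
    simpa using this
  have hrange : {x | orthogonal x (mk K v hv)} =
      Set.range (map (LinearMap.ker f).subtype (Submodule.injective_subtype _)) := by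
    ext x
    constructor
    · induction x using ind with | h w hw =>
      intro hx
      have hwf : w ∈ LinearMap.ker f := by
        rw [LinearMap.mem_ker]
        exact (dotProduct_comm v w).trans hx
      exact ⟨mk K ⟨w, hwf⟩ fun h => hw (congrArg Subtype.val h), rfl⟩
    · rintro ⟨y, rfl⟩
      induction y using ind with | h w hw =>
      exact (dotProduct_comm _ _).trans (LinearMap.mem_ker.1 w.2)
  rw [hrange, ← Nat.card_coe_set_eq, Nat.card_range_of_injective (map_injective _ _),
    card_of_finrank K _ hrank]

/-- Any `n` hyperplanes of an `n`-dimensional projective space have a common point. -/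
lemma exists_forall_orthogonal (s : Finset (ℙ K (Fin (n + 1) → K))) (hs : s.card ≤ n) :
    ∃ x, ∀ a ∈ s, orthogonal x a := by
  let f : (Fin (n + 1) → K) →ₗ[K] (s → K) :=
    LinearMap.pi fun a => dotProductBilin K K a.1.rep
  have hker : LinearMap.ker f ≠ ⊥ := LinearMap.ker_ne_bot_of_finrank_lt (by simpa using by omega)
  obtain ⟨v, hv, hv0⟩ := Submodule.exists_mem_ne_zero_of_ne_bot hker
  refine ⟨mk K v hv0, fun a ha => ?_⟩
  rw [← mk_rep a, orthogonal_mk, dotProduct_comm]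
  exact congrFun (LinearMap.mem_ker.1 hv) ⟨a, ha⟩

end Projectivization

theorem fracCover_pp_bound_sharp (q k : ℕ) (hq : IsPrimePow q) (hk : 2 ≤ k) :
    ∃ F : Finset (Set ℝ),
      (∀ s ∈ F, IsDInterval (∑ i ∈ Finset.range k, q ^ i) s) ∧
      HasPQProperty F k k ∧
      fracCoverNum F = (q : ℝ) + 1 / (∑ i ∈ Finset.range k, (q : ℝ) ^ i) := by
  classical
  obtain ⟨p, m, hp, hm, rfl⟩ := hq
  have : Fact p.Prime := ⟨hp.nat_prime⟩
  let K := GaloisField p m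
  let α := Projectivization K (Fin (k + 1) → K)
  have : Fintype α := Fintype.ofFinite α
  have hK : Nat.card K = p ^ m := GaloisField.card p m hm.ne'
  let e : α ↪ ℝ := (Fintype.equivFin α).toEmbedding.trans (Fin.valEmbedding.trans Nat.castEmbedding)
  set d := ∑ i ∈ Finset.range k, (p ^ m) ^ i with hd
  have hd0 : 0 < d := Finset.sum_pos (fun i _ => pow_pos (pow_pos hp.nat_prime.pos _) _)
    ⟨0, Finset.mem_range.2 (by omega)⟩
  have hncard (a : α) : {x | Projectivization.orthogonal x a}.ncard = d := by
    rw [Projectivization.ncard_orthogonal, hK]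
  have hα : Fintype.card α = p ^ m * d + 1 := by
    rw [← Nat.card_eq_fintype_card, Projectivization.card_of_finrank K _ (Module.finrank_fin_fun K),
      hK, Finset.sum_range_succ', hd, Finset.mul_sum]
    simp [pow_succ']
  refine ⟨Finset.univ.image fun a : α => e '' {x | Projectivization.orthogonal x a}, ?_, ?_, ?_⟩
  · intro s hs
    obtain ⟨a, -, rfl⟩ := Finset.mem_image.1 hs
    refine (Set.toFinite _).isDInterval ?_ ?_
    · refine Set.Nonempty.image _ (Set.nonempty_of_ncard_ne_zero ?_)
      rw [hncard]
      exact hd0.ne'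
    · rw [Set.ncard_image_of_injective _ e.injective, hncard]
  · intro S hS hcard
    refine ⟨S, subset_rfl, hcard, ?_⟩
    obtain ⟨t, -, hinj, rfl⟩ := Finset.exists_subset_injOn_image_eq_of_surjOn
      (f := fun a : α => e '' {x | Projectivization.orthogonal x a})
      Set.univ S fun s hs => by simpa using hS hs
    rw [Finset.card_image_of_injOn hinj] at hcard
    obtain ⟨x, hx⟩ := Projectivization.exists_forall_orthogonal t hcard.le
    refine ⟨e x, Set.mem_iInter₂.2 fun h hh => ?_⟩
    obtain ⟨a, ha, rfl⟩ := Finset.mem_image.1 hh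
    exact Set.mem_image_of_mem _ (hx a ha)
  · have hd' : (d : ℝ) ≠ 0 := by exact_mod_cast hd0.ne'
    have hcast : ∑ i ∈ Finset.range k, ((p ^ m : ℕ) : ℝ) ^ i = d := by simp [hd]
    rw [hcast]
    convert fracCoverNum_image_of_regular e (fun x a : α => Projectivization.orthogonal x a)
      (fun _ _ => Projectivization.orthogonal_comm.1) hd0 fun a => ?_
    · rw [hα]
      push_cast
      field_simp
    · rw [← hncard a, ← Set.ncard_coe_finset]
      congr 1
      ext
      simp only [Finset.coe_filter, Finset.mem_univ, true_and]
      rfl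
end

section
/- Let G be a finite tree, let p ≥ q ≥ 2 and d ≥ 1 be integers, and let H be a finite family of nonempty subsets of the vertex set of G, each inducing a subgraph of G with at most d connected components, with |H| ≥ p. If H satisfies the (p,q) property, then the covering number satisfies τ(H) ≤ max{ (2^{1/(q-1)} · (e·p)^{q/(q-1)} / q) · d^{q/(q-1)} + d , 2·p²·d }. -/
/-- A finite family `H` of vertex sets satisfies the `(p,q)` property if among
every `p` distinct members of `H` some `q` have a vertex in common. -/
def VertexPQProperty {V : Type*} (H : Finset (Set V)) (p q : ℕ) : Prop :=
  ∀ S ⊆ H, S.card = p → ∃ T ⊆ S, T.card = q ∧ (⋂ h ∈ T, (h : Set V)).Nonempty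

/-- The covering number `τ(H)`: the minimum cardinality of a set of vertices
meeting every member of `H`. -/
noncomputable def vertexCoverNum {V : Type*} (H : Finset (Set V)) : ℕ :=
  sInf { n : ℕ | ∃ C : Finset V, C.card = n ∧ ∀ h ∈ H, ∃ v ∈ C, v ∈ h }

/-- The fractional covering number `τ*(H)`: the infimum of total weights of
fractional covers of `H`. -/
noncomputable def vertexFracCoverNum {V : Type*} [Fintype V] (H : Finset (Set V)) : ℝ :=
  sInf { t : ℝ | ∃ w : V → ℝ, (∀ v, 0 ≤ w v) ∧
    (∀ h ∈ H, 1 ≤ ∑ v, Set.indicator h w v) ∧ t = ∑ v, w v }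

namespace ParentForest

variable {V : Type*} {π : V → V} {rk : V → ℕ}

/-- `y` is a top vertex of `h`: it lies in `h`, and it is a root or its parent is outside `h`. -/
def IsTop (π : V → V) (h : Set V) (y : V) : Prop :=
  y ∈ h ∧ (π y = y ∨ π y ∉ h)

/-- Following parents from `z` one reaches `y` without leaving `h`. -/
def ClimbsTo (π : V → V) (h : Set V) (z y : V) : Prop :=
  ∃ k, π^[k] z = y ∧ ∀ j ≤ k, π^[j] z ∈ h

lemma iterate_eq_or_rank_lt (hπ : ∀ v, π v = v ∨ rk (π v) < rk v) (k : ℕ) (z : V) :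
    π^[k] z = z ∨ rk (π^[k] z) < rk z := by
  induction k with
  | zero => exact Or.inl rfl
  | succ k ih =>
    rw [Function.iterate_succ_apply']
    have := hπ (π^[k] z)
    grind

lemma exists_isTop_climbsTo (hπ : ∀ v, π v = v ∨ rk (π v) < rk v) {h : Set V} {z : V}
    (hz : z ∈ h) : ∃ y, IsTop π h y ∧ ClimbsTo π h z y := by
  induction hn : rk z using Nat.strong_induction_on generalizing z with
  | _ n ih =>
    by_cases hroot : π z = z ∨ π z ∉ h
    · exact ⟨z, ⟨hz, hroot⟩, 0, rfl, by simpa using hz⟩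
    · push Not at hroot
      have hlt : rk (π z) < n := hn ▸ (hπ z).resolve_left hroot.1
      obtain ⟨y, hy, k, hk, hmem⟩ := ih _ hlt hroot.2 rfl
      refine ⟨y, hy, k + 1, by rwa [Function.iterate_succ_apply], fun j hj => ?_⟩
      cases j with
      | zero => exact hz
      | succ j => simpa [Function.iterate_succ_apply] using hmem j (by omega)

lemma ClimbsTo.mem_left {h : Set V} {z y : V} (hc : ClimbsTo π h z y) : z ∈ h := by
  obtain ⟨k, -, hmem⟩ := hc
  exact hmem 0 (Nat.zero_le _)

lemma ClimbsTo.mem_right {h : Set V} {z y : V} (hc : ClimbsTo π h z y) : y ∈ h := by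
  obtain ⟨k, rfl, hmem⟩ := hc
  exact hmem k le_rfl

lemma ClimbsTo.refl {h : Set V} {y : V} (hy : y ∈ h) : ClimbsTo π h y y :=
  ⟨0, rfl, by simpa using hy⟩

/-- If two climbs start at the same vertex, the end of the lower one lies on the other. -/
lemma ClimbsTo.of_rank_le (hπ : ∀ v, π v = v ∨ rk (π v) < rk v) {h h' : Set V} {z y y' : V}
    (hc : ClimbsTo π h z y) (hc' : ClimbsTo π h' z y') (hr : rk y' ≤ rk y) :
    ClimbsTo π h' y y' := by
  have hy' := hc'.mem_right
  obtain ⟨k, rfl, -⟩ := hc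
  obtain ⟨k', rfl, hmem⟩ := hc'
  rcases le_total k k' with hk | hk
  · obtain ⟨m, rfl⟩ := Nat.exists_eq_add_of_le hk
    refine ⟨m, by rw [← Function.iterate_add_apply, Nat.add_comm], fun j hj => ?_⟩
    rw [← Function.iterate_add_apply]
    exact hmem _ (by omega)
  · obtain ⟨m, rfl⟩ := Nat.exists_eq_add_of_le hk
    rw [Nat.add_comm k' m, Function.iterate_add_apply] at hr ⊢
    rcases iterate_eq_or_rank_lt hπ m (π^[k'] z) with h1 | h1
    · rw [h1]
      exact .refl hy'
    · omega

/-- If finitely many sets share a vertex, then a top vertex of one of them lies in all. -/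
lemma exists_isTop_mem_of_common (hπ : ∀ v, π v = v ∨ rk (π v) < rk v) {ι : Type*}
    {T : Finset ι} (hT : T.Nonempty) {h : ι → Set V} {v : V} (hv : ∀ i ∈ T, v ∈ h i) :
    ∃ i ∈ T, ∃ y, IsTop π (h i) y ∧ ∀ j ∈ T, y ∈ h j := by
  have key : ∀ i, ∃ k, i ∈ T → IsTop π (h i) (π^[k] v) ∧ ∀ j ≤ k, π^[j] v ∈ h i := by
    intro i
    by_cases hi : i ∈ T
    · obtain ⟨y, hy, k, rfl, hmem⟩ := exists_isTop_climbsTo hπ (hv i hi)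
      exact ⟨k, fun _ => ⟨hy, hmem⟩⟩
    · exact ⟨0, fun h => absurd h hi⟩
  choose k hk using key
  obtain ⟨i, hi, hmin⟩ := T.exists_min_image k hT
  exact ⟨i, hi, _, (hk i hi).1, fun j hj => (hk j hj).2 _ (hmin j hj)⟩

end ParentForest

open ParentForest

lemma SimpleGraph.IsTree.eq_of_adj_of_dist_lt {V : Type*} {G : SimpleGraph V} (hG : G.IsTree)
    {r v u w : V} (hu : G.Adj v u) (hw : G.Adj v w) (hdu : G.dist r u < G.dist r v)
    (hdw : G.dist r w < G.dist r v) : u = w := by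
  have penult : ∀ x, G.Adj v x → G.dist r x < G.dist r v →
      ∃ P : G.Walk r v, P.IsPath ∧ P.penultimate = x := by
    intro x hx hdx
    obtain ⟨P, hP⟩ := hG.connected.exists_walk_length_eq_dist r x
    refine ⟨P.concat hx.symm, ?_, SimpleGraph.Walk.penultimate_concat _ _⟩
    apply SimpleGraph.Walk.isPath_of_length_eq_dist
    have := hG.dist_eq_dist_add_one_of_adj r hx
    rw [SimpleGraph.Walk.length_concat]
    omega
  obtain ⟨P, hP, rfl⟩ := penult u hu hdu
  obtain ⟨Q, hQ, rfl⟩ := penult w hw hdw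
  rw [(hG.existsUnique_path r v).unique hP hQ]

/-- A finite tree carries a parent function for which every vertex set has at most as many top
vertices as it has connected components. -/
lemma SimpleGraph.IsTree.exists_parent {V : Type*} [Finite V] {G : SimpleGraph V}
    (hG : G.IsTree) :
    ∃ (π : V → V) (rk : V → ℕ), (∀ v, π v = v ∨ rk (π v) < rk v) ∧
      ∀ h : Set V, {y | IsTop π h y}.ncard ≤ Nat.card (G.induce h).ConnectedComponent := by
  obtain ⟨r⟩ := hG.connected.nonempty
  have key : ∀ v, ∃ u, (∀ w, G.Adj v w → G.dist r w < G.dist r v → w = u) ∧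
      (u = v ∨ G.dist r u < G.dist r v) := by
    intro v
    by_cases hv : ∃ u, G.Adj v u ∧ G.dist r u < G.dist r v
    · obtain ⟨u, hu, hdu⟩ := hv
      exact ⟨u, fun w hw hdw => hG.eq_of_adj_of_dist_lt hw hu hdw hdu, Or.inr hdu⟩
    · exact ⟨v, fun w hw hdw => absurd ⟨w, hw, hdw⟩ hv, Or.inl rfl⟩
  choose π hparent hπ using key
  refine ⟨π, G.dist r, hπ, fun h => ?_⟩
  have descend : ∀ y, IsTop π h y → ∀ a b : h, (G.induce h).Reachable a b → (a : V) = y →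
      ∃ k, π^[k] (b : V) = y := by
    rintro y ⟨-, hy⟩ a b hab ha
    rw [SimpleGraph.reachable_iff_reflTransGen] at hab
    induction hab with
    | refl => exact ⟨0, ha⟩
    | @tail z z' _ hadj ih =>
      obtain ⟨k, hk⟩ := ih
      have hadj' : G.Adj z z' := hadj
      rcases hG.dist_eq_dist_add_one_of_adj r hadj' with hd | hd
      · have hz' : (z' : V) = π z := hparent z z' hadj' (by omega)
        cases k with
        | zero =>
          have hzy : (z : V) = y := hk
          rw [← hzy, ← hz'] at hy
          rcases hy with hy | hy
          · exact absurd hy.symm hadj'.ne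
          · exact absurd z'.2 hy
        | succ k => exact ⟨k, by rw [hz', ← Function.iterate_succ_apply, hk]⟩
      · have hz : (z : V) = π z' := hparent z' z hadj'.symm (by omega)
        exact ⟨k + 1, by rw [Function.iterate_succ_apply, ← hz, hk]⟩
  refine Nat.card_le_card_of_injective
    (fun y : {y | IsTop π h y} => (G.induce h).connectedComponentMk ⟨y, y.2.1⟩) ?_
  rintro ⟨y, hy⟩ ⟨y', hy'⟩ hyy'
  have hreach := SimpleGraph.ConnectedComponent.exact hyy'
  obtain ⟨k, hk⟩ := descend y hy _ _ hreach rfl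
  obtain ⟨l, hl⟩ := descend y' hy' _ _ hreach.symm rfl
  simp only at hk hl
  have h1 := iterate_eq_or_rank_lt hπ k y'
  have h2 := iterate_eq_or_rank_lt hπ l y
  rw [hk] at h1
  rw [hl] at h2
  ext
  show y = y'
  rcases h1 with h1 | h1
  · exact h1
  · rcases h2 with h2 | h2
    · exact h2.symm
    · omega

/-- Greedy piercing: if each set is met at its base point by every intersecting set of smaller
rank, then a family is pierced by at most as many points as it has pairwise disjoint members. -/
lemma exists_cover_and_pairwiseDisjoint {ι V : Type*} (F : Finset ι) (S : ι → Set V) (t : ι → V)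
    (rk : ι → ℕ) (hne : ∀ i ∈ F, (S i).Nonempty)
    (ht : ∀ i ∈ F, ∀ j ∈ F, rk j ≤ rk i → (S i ∩ S j).Nonempty → t i ∈ S j) :
    ∃ (C : Finset V) (D : Finset ι), D ⊆ F ∧ C.card ≤ D.card ∧
      (D : Set ι).PairwiseDisjoint S ∧ ∀ i ∈ F, ∃ v ∈ C, v ∈ S i := by
  classical
  induction hn : F.card using Nat.strong_induction_on generalizing F with
  | _ n ih =>
    rcases F.eq_empty_or_nonempty with rfl | hF
    · exact ⟨∅, ∅, by simp⟩
    obtain ⟨i, hi, hmax⟩ := F.exists_max_image rk hF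
    have hii : t i ∈ S i := ht i hi i hi le_rfl (by simpa using hne i hi)
    set F' := F.filter (fun j => t i ∉ S j) with hF'
    have hsub : F' ⊆ F := Finset.filter_subset _ _
    have hlt : F'.card < n := by
      rw [← hn]
      exact Finset.card_lt_card (Finset.filter_ssubset.2 ⟨i, hi, not_not.2 hii⟩)
    obtain ⟨C, D, hDF, hCD, hdisj, hcov⟩ := ih _ hlt F' (fun j hj => hne j (hsub hj))
      (fun j hj k hk => ht j (hsub hj) k (hsub hk)) rfl
    have hiD : i ∉ D := fun h => (Finset.mem_filter.1 (hDF h)).2 hii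
    refine ⟨insert (t i) C, insert i D, Finset.insert_subset hi (hDF.trans hsub), ?_, ?_, ?_⟩
    · rw [Finset.card_insert_of_notMem hiD]
      exact (Finset.card_insert_le _ _).trans (by omega)
    · rw [Finset.coe_insert]
      refine hdisj.insert fun j hj _ => ?_
      rw [Set.disjoint_iff_inter_eq_empty, ← Set.not_nonempty_iff_eq_empty]
      have hj' := Finset.mem_filter.1 (hDF hj)
      exact fun h => hj'.2 (ht i hi j hj'.1 (hmax j hj'.1) h)
    · intro j hj
      by_cases h : t i ∈ S j
      · exact ⟨t i, Finset.mem_insert_self _ _, h⟩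
      · obtain ⟨v, hv, hvj⟩ := hcov j (Finset.mem_filter.2 ⟨hj, h⟩)
        exact ⟨v, Finset.mem_insert_of_mem hv, hvj⟩

open Classical in
/-- A weight of total mass one giving every member mass at least `c` yields a cover of size at most
`d / c`, when each member has at most `d` top vertices. -/
lemma exists_cover_of_weight {V : Type*} [Fintype V] {π : V → V} {rk : V → ℕ}
    (hπ : ∀ v, π v = v ∨ rk (π v) < rk v) {d : ℕ} {H : Finset (Set V)}
    (hne : ∀ h ∈ H, h.Nonempty) (hd : ∀ h ∈ H, {y | IsTop π h y}.ncard ≤ d)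
    {w : V → ℝ} (hw0 : ∀ v, 0 ≤ w v) (hw1 : ∑ v, w v = 1) {c : ℝ} (hc : 0 < c)
    (hw : ∀ h ∈ H, c ≤ ∑ v, if v ∈ h then w v else 0) :
    ∃ C : Finset V, (∀ h ∈ H, ∃ v ∈ C, v ∈ h) ∧ C.card * c ≤ d := by
  have key : ∀ h, ∃ y, h ∈ H → IsTop π h y ∧
      c ≤ d * ∑ v, if ClimbsTo π h v y then w v else 0 := by
    intro h
    by_cases hh : h ∈ H
    swap
    · obtain ⟨v⟩ : Nonempty V := by
        by_contra hV
        rw [not_nonempty_iff] at hV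
        simp at hw1
      exact ⟨v, fun h => absurd h hh⟩
    by_contra! hcon
    have hcon' : ∀ y, IsTop π h y → d * (∑ v, if ClimbsTo π h v y then w v else 0) < c :=
      fun y => (hcon y).2
    set T := Finset.univ.filter (fun y => IsTop π h y) with hT
    have hTne : T.Nonempty := by
      obtain ⟨z, hz⟩ := hne h hh
      obtain ⟨y, hy, -⟩ := exists_isTop_climbsTo hπ hz
      exact ⟨y, by simp [hT, hy]⟩
    have hTd : T.card ≤ d := by
      have := hd h hh
      rwa [Set.ncard_eq_toFinset_card', Set.toFinset_ofPred] at this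
    have hle : ∑ v, (if v ∈ h then w v else 0) ≤
        ∑ y ∈ T, ∑ v, if ClimbsTo π h v y then w v else 0 := by
      rw [Finset.sum_comm]
      refine Finset.sum_le_sum fun v _ => ?_
      have hnn : ∀ y ∈ T, 0 ≤ if ClimbsTo π h v y then w v else 0 := fun y _ => by
        split_ifs <;> simp [hw0]
      split_ifs with hv
      · obtain ⟨y, hy, hvy⟩ := exists_isTop_climbsTo hπ hv
        have := Finset.single_le_sum hnn (a := y) (by simp [hT, hy])
        simpa [hvy] using this
      · exact Finset.sum_nonneg hnn
    have hlt : ∑ y ∈ T, d * (∑ v, if ClimbsTo π h v y then w v else 0) < ∑ y ∈ T, c :=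
      Finset.sum_lt_sum_of_nonempty hTne fun y hy => hcon' y (by simpa [hT] using hy)
    rw [← Finset.mul_sum, Finset.sum_const, nsmul_eq_mul] at hlt
    have h1 : d * c ≤ d * ∑ y ∈ T, ∑ v, if ClimbsTo π h v y then w v else 0 :=
      mul_le_mul_of_nonneg_left ((hw h hh).trans hle) (Nat.cast_nonneg d)
    have h2 : (T.card : ℝ) * c ≤ d * c :=
      mul_le_mul_of_nonneg_right (by exact_mod_cast hTd) hc.le
    linarith
  choose t ht using key
  obtain ⟨C, D, hDH, hCD, hdisj, hcov⟩ := exists_cover_and_pairwiseDisjoint H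
    (fun h => {v | ClimbsTo π h v (t h)}) t (fun h => rk (t h))
    (fun h hh => ⟨t h, ClimbsTo.refl (ht h hh).1.1⟩) (by
      rintro h hh h' hh' hr ⟨v, hv, hv'⟩
      exact ClimbsTo.of_rank_le hπ hv hv' hr)
  refine ⟨C, fun h hh => ?_, ?_⟩
  · obtain ⟨v, hv, hvh⟩ := hcov h hh
    exact ⟨v, hv, ClimbsTo.mem_left hvh⟩
  have hsum : ∑ h ∈ D, ∑ v, (if ClimbsTo π h v (t h) then w v else 0) ≤ 1 := by
    rw [← hw1, Finset.sum_comm]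
    refine Finset.sum_le_sum fun v _ => ?_
    by_cases hv : ∃ h ∈ D, ClimbsTo π h v (t h)
    · obtain ⟨h, hh, hvh⟩ := hv
      rw [Finset.sum_eq_single_of_mem h hh]
      · rw [if_pos hvh]
      · intro h' hh' hne'
        refine if_neg fun hv' => ?_
        exact Set.disjoint_left.1 (hdisj hh' hh hne') hv' hvh
    · push Not at hv
      rw [Finset.sum_eq_zero fun h hh => if_neg (hv h hh)]
      exact hw0 v
  calc (C.card : ℝ) * c ≤ D.card * c :=
        mul_le_mul_of_nonneg_right (by exact_mod_cast hCD) hc.le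
    _ = ∑ h ∈ D, c := by simp
    _ ≤ ∑ h ∈ D, d * ∑ v, (if ClimbsTo π h v (t h) then w v else 0) :=
        Finset.sum_le_sum fun h hh => (ht h (hDH hh)).2
    _ = d * ∑ h ∈ D, ∑ v, (if ClimbsTo π h v (t h) then w v else 0) := by
        rw [Finset.mul_sum]
    _ ≤ d := mul_le_of_le_one_right (Nat.cast_nonneg d) hsum

/-- Theorem of the alternative for a finite matrix game with value threshold `t`. -/
lemma exists_row_or_column_strategy {α V : Type*} [Fintype α] [Fintype V] [Nonempty α]
    (A : α → V → ℝ) (t : ℝ) :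
    (∃ μ : α → ℝ, (∀ a, 0 ≤ μ a) ∧ ∑ a, μ a = 1 ∧ ∀ v, ∑ a, μ a * A a v ≤ t) ∨
    (∃ w : V → ℝ, (∀ v, 0 ≤ w v) ∧ ∑ v, w v = 1 ∧ ∀ a, t < ∑ v, w v * A a v) := by
  classical
  by_cases hμ : ∃ μ ∈ stdSimplex ℝ α, ∀ v, ∑ a, μ a * A a v ≤ t
  · obtain ⟨μ, hμ, h⟩ := hμ
    exact Or.inl ⟨μ, hμ.1, hμ.2, h⟩
  right
  push Not at hμ
  let B : (α → ℝ) →ₗ[ℝ] (V → ℝ) →ₗ[ℝ] ℝ := Matrix.toLinearMap₂' ℝ (Matrix.of A)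
  have hB : ∀ μ w, B μ w = ∑ a, ∑ v, μ a * (w v * A a v) := by
    intro μ w
    simp [B, Matrix.toLinearMap₂'_apply]
  have hcont₁ : ∀ w, Continuous fun μ => B μ w := fun w => by
    simp only [hB]; fun_prop
  have hcont₂ : ∀ μ, Continuous fun w => B μ w := fun μ => by
    simp only [hB]; fun_prop
  obtain ⟨w, hw, h⟩ := Sion.exists_lt_iInf_of_lt_iInf_of_finite
    (X := stdSimplex ℝ α) (Y := stdSimplex ℝ V) (f := fun μ w => B μ w) (t := t)
    (s := Set.range fun v => (Pi.single v 1 : V → ℝ))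
    ⟨_, single_mem_stdSimplex ℝ (Classical.arbitrary α)⟩ (isCompact_stdSimplex ℝ α)
    (fun w _ => (hcont₁ w).lowerSemicontinuous.lowerSemicontinuousOn _)
    (fun w _ => ((B.flip w).convexOn (convex_stdSimplex ℝ α)).quasiconvexOn)
    (convex_stdSimplex ℝ V)
    (fun μ _ => (hcont₂ μ).upperSemicontinuous.upperSemicontinuousOn _)
    (fun μ _ => ((B μ).concaveOn (convex_stdSimplex ℝ V)).quasiconcaveOn)
    (convex_stdSimplex ℝ α) (Set.finite_range _)
    (by rintro _ ⟨v, rfl⟩; exact single_mem_stdSimplex ℝ v)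
    (by
      intro μ hμ'
      obtain ⟨v, hv⟩ := hμ μ hμ'
      exact ⟨_, ⟨v, rfl⟩, by simpa [hB, Pi.single_apply] using hv⟩)
  refine ⟨w, hw.1, hw.2, fun a => ?_⟩
  simpa [hB, Pi.single_apply] using h _ (single_mem_stdSimplex ℝ a)

open Classical in
/-- For independent samples, the probability that all samples indexed by `s` are `R`-related to the
sample at `i ∉ s` is at most `L ^ #s`, if every point is `R`-related to mass at most `L`. -/
lemma sum_prod_related_le {ι α : Type*} [Fintype ι] [DecidableEq ι] [Fintype α] {μ : α → ℝ}
    (hμ0 : ∀ a, 0 ≤ μ a) (hμ1 : ∑ a, μ a = 1) (R : α → α → Prop) {L : ℝ}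
    (hR : ∀ a, ∑ b, (if R a b then μ b else 0) ≤ L) {i : ι} {s : Finset ι} (hi : i ∉ s) :
    ∑ f : ι → α, (if ∀ j ∈ s, R (f i) (f j) then ∏ j, μ (f j) else 0) ≤ L ^ s.card := by
  let g : α → ι → α → ℝ := fun a j x =>
    if j = i then (if x = a then μ x else 0) else if j ∈ s then (if R a x then μ x else 0) else μ x
  have hg0 : ∀ a j x, 0 ≤ g a j x := by
    intro a j x
    simp only [g]
    split_ifs <;> simp [hμ0]
  have hterm : ∀ f : ι → α, (if ∀ j ∈ s, R (f i) (f j) then ∏ j, μ (f j) else 0) =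
      ∑ a, ∏ j, g a j (f j) := by
    intro f
    rw [Finset.sum_eq_single_of_mem (f i) (Finset.mem_univ _)]
    · split_ifs with h
      · refine Finset.prod_congr rfl fun j _ => ?_
        simp only [g]
        split_ifs with h1 h2 h3 h4
        · rfl
        · exact absurd (h1 ▸ rfl) h2
        · rfl
        · exact absurd (h j h3) h4
        · rfl
      · push Not at h
        obtain ⟨j, hj, hRj⟩ := h
        refine (Finset.prod_eq_zero (Finset.mem_univ j) ?_).symm
        have hji : j ≠ i := fun h => hi (h ▸ hj)
        simp [g, hji, hj, hRj]
    · intro a _ ha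
      refine Finset.prod_eq_zero (Finset.mem_univ i) ?_
      simp [g, ha.symm]
  simp only [hterm]
  rw [Finset.sum_comm]
  calc ∑ a, ∑ f : ι → α, ∏ j, g a j (f j)
      = ∑ a, ∏ j, ∑ x, g a j x := by simp only [Fintype.prod_sum]
    _ ≤ ∑ a, ∏ j, (if j = i then μ a else if j ∈ s then L else 1) := by
        refine Finset.sum_le_sum fun a _ => Finset.prod_le_prod
          (fun j _ => Finset.sum_nonneg fun x _ => hg0 a j x) fun j _ => ?_
        simp only [g]
        split_ifs
        · simp
        · exact hR a
        · exact hμ1.le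
    _ = ∑ a, μ a * L ^ s.card := by
        refine Finset.sum_congr rfl fun a _ => ?_
        rw [← Finset.mul_prod_erase _ _ (Finset.mem_univ i), if_pos rfl]
        congr 1
        rw [← Finset.prod_const, ← Finset.prod_subset (s₁ := s)]
        · refine Finset.prod_congr rfl fun j hj => ?_
          have hji : j ≠ i := fun h => hi (h ▸ hj)
          rw [if_neg hji, if_pos hj]
        · exact fun j hj => Finset.mem_erase.2 ⟨fun h => hi (h ▸ hj), Finset.mem_univ _⟩
        · intro j hj hjs
          rw [if_neg (Finset.ne_of_mem_erase hj), if_neg hjs]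
    _ = L ^ s.card := by rw [← Finset.sum_mul, hμ1, one_mul]

open Classical in
/-- Union bound. -/
lemma sum_le_sum_of_forall_exists {Ω κ : Type*} [Fintype Ω] {P : Ω → ℝ} (hP : ∀ f, 0 ≤ P f)
    (K : Finset κ) (E : κ → Ω → Prop) (ε : κ → ℝ)
    (hε : ∀ k ∈ K, ∑ f, (if E k f then P f else 0) ≤ ε k) :
    ∑ f, (if ∃ k ∈ K, E k f then P f else 0) ≤ ∑ k ∈ K, ε k := by
  refine le_trans ?_ (Finset.sum_le_sum hε)
  rw [Finset.sum_comm]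
  refine Finset.sum_le_sum fun f _ => ?_
  have hnn : ∀ k ∈ K, 0 ≤ if E k f then P f else 0 := fun k _ => by
    split_ifs <;> simp [hP]
  split_ifs with h
  · obtain ⟨k, hk, hkf⟩ := h
    simpa [hkf] using Finset.single_le_sum hnn hk
  · exact Finset.sum_nonneg hnn

open Classical in
/-- Sampling `p` members independently: either two coincide, or one of the `d` base points of one
member lies in `q - 1` others. -/
lemma one_le_of_forall_injective {α V : Type*} [Fintype α] {μ : α → ℝ}
    (hμ0 : ∀ a, 0 ≤ μ a) (hμ1 : ∑ a, μ a = 1) {A : α → Set V} (hne : ∀ a, (A a).Nonempty)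
    {L : ℝ} (hL : ∀ v, ∑ a, (if v ∈ A a then μ a else 0) ≤ L) {p q d : ℕ} (t : α → Fin d → V)
    (hstar : ∀ f : Fin p → α, Function.Injective f → ∃ T : Finset (Fin p), T.card = q ∧
      ∃ i ∈ T, ∃ c, ∀ j ∈ T, t (f i) c ∈ A (f j)) :
    1 ≤ p * (p - 1) * L + p.choose q * (q * (d * L ^ (q - 1))) := by
  have hμL : ∀ a, μ a ≤ L := by
    intro a
    obtain ⟨v, hv⟩ := hne a
    have := Finset.single_le_sum (f := fun a => if v ∈ A a then μ a else 0)
      (fun b _ => by split_ifs <;> simp [hμ0]) (Finset.mem_univ a)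
    simp only [hv, if_true] at this
    exact this.trans (hL v)
  let P : (Fin p → α) → ℝ := fun f => ∏ j, μ (f j)
  have hP : ∀ f, 0 ≤ P f := fun f => Finset.prod_nonneg fun j _ => hμ0 _
  have hP1 : ∑ f, P f = 1 := by
    simp only [P]
    rw [← Fintype.prod_sum (fun (_ : Fin p) a => μ a)]
    simp [hμ1]
  have hcoll := sum_le_sum_of_forall_exists hP (Finset.univ : Finset (Fin p)).offDiag
    (fun e f => f e.1 = f e.2) (fun _ => L) (by
      rintro ⟨i, j⟩ hij
      have hij' : i ≠ j := (Finset.mem_offDiag.1 hij).2.2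
      simpa [P] using sum_prod_related_le hμ0 hμ1 (fun a b => a = b) (L := L)
        (by simpa using hμL) (i := i) (s := {j}) (by simpa using hij'))
  have hstars := sum_le_sum_of_forall_exists hP
    ((Finset.powersetCard q (Finset.univ : Finset (Fin p))).sigma
      fun T => T ×ˢ (Finset.univ : Finset (Fin d)))
    (fun k f => ∀ j ∈ k.1.erase k.2.1, t (f k.2.1) k.2.2 ∈ A (f j)) (fun _ => L ^ (q - 1)) (by
      rintro ⟨T, i, c⟩ hk
      simp only [Finset.mem_sigma, Finset.mem_powersetCard, Finset.mem_product] at hk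
      have := sum_prod_related_le hμ0 hμ1 (fun a b => t a c ∈ A b) (fun a => hL _)
        (Finset.notMem_erase i T)
      rw [Finset.card_erase_of_mem hk.2.1, hk.1.2] at this
      convert this)
  have hle : ∑ f, P f ≤ _ := le_trans ?_ (add_le_add hcoll hstars)
  · rw [hP1] at hle
    refine hle.trans (le_of_eq ?_)
    rw [Finset.sum_const, Finset.offDiag_card, Finset.sum_sigma,
      Finset.sum_congr rfl fun T hT => by
        rw [Finset.sum_const, Finset.card_product, (Finset.mem_powersetCard.1 hT).2]]
    simp only [Finset.card_univ, Fintype.card_fin, Finset.sum_const, Finset.card_powersetCard,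
      nsmul_eq_mul]
    rw [Nat.cast_sub (Nat.le_mul_self p)]
    push_cast
    ring
  · rw [← Finset.sum_add_distrib]
    refine Finset.sum_le_sum fun f _ => ?_
    by_cases hf : Function.Injective f
    · obtain ⟨T, hT, i, hi, c, hc⟩ := hstar f hf
      refine le_trans ?_ (le_add_of_nonneg_left (by split_ifs <;> simp [hP]))
      rw [if_pos]
      exact ⟨⟨T, i, c⟩, by simp [hT, hi], fun j hj => hc j (Finset.mem_of_mem_erase hj)⟩
    · refine le_trans ?_ (le_add_of_nonneg_right (by split_ifs <;> simp [hP]))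
      rw [if_pos]
      simp only [Function.Injective, not_forall] at hf
      obtain ⟨i, j, hij, hne'⟩ := hf
      exact ⟨(i, j), by simpa using hne', hij⟩

lemma Nat.choose_le_exp_mul_div_pow (p q : ℕ) (hq : 1 ≤ q) :
    (p.choose q : ℝ) ≤ (Real.exp 1 * p / q) ^ q := by
  have hq0 : (0 : ℝ) < q := by exact_mod_cast hq
  have hf : (0 : ℝ) < q.factorial := by exact_mod_cast q.factorial_pos
  have h1 : (p.choose q : ℝ) ≤ (p : ℝ) ^ q / q.factorial := Nat.choose_le_pow_div q p
  have h2 : (q : ℝ) ^ q / q.factorial ≤ Real.exp 1 ^ q := by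
    rw [← Real.exp_nat_mul, mul_one]
    exact Real.pow_div_factorial_le_exp _ hq0.le q
  refine h1.trans ?_
  rw [div_pow, mul_pow, le_div_iff₀ (by positivity)]
  calc (p : ℝ) ^ q / q.factorial * q ^ q = (q : ℝ) ^ q / q.factorial * p ^ q := by ring
    _ ≤ Real.exp 1 ^ q * p ^ q := by gcongr

/-- A sampling inequality bounds the reciprocal of the mass parameter. -/
lemma le_of_sampling_inequality {p q d : ℕ} (hq : 2 ≤ q) (hp : 1 ≤ p) {M : ℝ}
    (hM : 2 * (p : ℝ) ^ 2 ≤ M)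
    (h : 1 ≤ p * (p - 1) * M⁻¹ + p.choose q * (q * (d * M⁻¹ ^ (q - 1)))) :
    M ≤ (2 : ℝ) ^ (1 / ((q : ℝ) - 1)) * (Real.exp 1 * p) ^ ((q : ℝ) / ((q : ℝ) - 1)) / q
        * (d : ℝ) ^ (1 / ((q : ℝ) - 1)) := by
  have hq0 : (0 : ℝ) < q := by positivity
  have hp0 : (1 : ℝ) ≤ p := by exact_mod_cast hp
  have hM0 : 0 < M := by nlinarith
  have hcoll : p * (p - 1) * M⁻¹ ≤ 1 / 2 := by
    rw [← div_eq_mul_inv, div_le_iff₀ hM0]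
    nlinarith
  obtain ⟨n, rfl⟩ : ∃ n, q = n + 1 := ⟨q - 1, by omega⟩
  have hn : n ≠ 0 := by omega
  have hn0 : (n : ℝ) ≠ 0 := by exact_mod_cast hn
  have hsub : ((n + 1 : ℕ) : ℝ) - 1 = n := by push_cast; ring
  rw [Nat.add_sub_cancel] at h
  rw [hsub]
  have hchoose := Nat.choose_le_exp_mul_div_pow p (n + 1) (by omega)
  set E : ℝ := Real.exp 1 * p with hE
  have hE0 : 0 ≤ E := by positivity
  set Q : ℝ := ((n + 1 : ℕ) : ℝ) with hQ
  have hMn : M ^ n ≤ 2 * E ^ (n + 1) / Q ^ n * d := by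
    have h1 : 1 / 2 ≤ (E / Q) ^ (n + 1) * (Q * (d * M⁻¹ ^ n)) := by
      refine le_trans (by linarith) (mul_le_mul_of_nonneg_right hchoose (by positivity))
    rw [inv_pow] at h1
    have h2 : (E / Q) ^ (n + 1) * (Q * (d * (M ^ n)⁻¹)) = E ^ (n + 1) / Q ^ n * d / M ^ n := by
      rw [div_pow, pow_succ Q]
      field_simp
    rw [h2, le_div_iff₀ (by positivity)] at h1
    calc M ^ n = 2 * (1 / 2 * M ^ n) := by ring
      _ ≤ 2 * (E ^ (n + 1) / Q ^ n * d) := by gcongr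
      _ = _ := by ring
  refine le_of_pow_le_pow_left₀ hn (by positivity) (hMn.trans (le_of_eq ?_))
  have hroot : ∀ x : ℝ, 0 ≤ x → (x ^ (1 / (n : ℝ))) ^ n = x := fun x hx => by
    rw [one_div, Real.rpow_inv_natCast_pow hx hn]
  have hEroot : (E ^ (Q / n)) ^ n = E ^ (n + 1) := by
    rw [← Real.rpow_natCast, ← Real.rpow_mul hE0, div_mul_cancel₀ _ hn0, hQ, Real.rpow_natCast]
  rw [mul_pow (_ / Q), div_pow, mul_pow (2 ^ (1 / (n : ℝ))), hroot 2 (by norm_num),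
    hroot d (by positivity), hEroot]

theorem tree_cover_of_pq_property {V : Type*} [Fintype V]
    (G : SimpleGraph V) (hG : G.IsTree)
    (p q d : ℕ) (hq : 2 ≤ q) (hqp : q ≤ p) (hd : 1 ≤ d)
    (H : Finset (Set V)) (hne : ∀ h ∈ H, h.Nonempty)
    (hcomp : ∀ h ∈ H, Nat.card (G.induce h).ConnectedComponent ≤ d)
    (hcard : p ≤ H.card)
    (hprop : VertexPQProperty H p q) :
    (vertexCoverNum H : ℝ) ≤ max
      ((2 : ℝ) ^ (1 / ((q : ℝ) - 1)) * (Real.exp 1 * p) ^ ((q : ℝ) / ((q : ℝ) - 1)) / q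
        * (d : ℝ) ^ ((q : ℝ) / ((q : ℝ) - 1)) + d)
      (2 * (p : ℝ) ^ 2 * d) := by
  classical
  obtain ⟨π, rk, hπ, hntop⟩ := hG.exists_parent
  have htop : ∀ h ∈ H, {y | IsTop π h y}.ncard ≤ d := fun h hh => (hntop h).trans (hcomp h hh)
  have hd0 : (0 : ℝ) < d := by exact_mod_cast hd
  have hp0 : (0 : ℝ) < p := by exact_mod_cast (by omega : 0 < p)
  set K : ℝ := (2 : ℝ) ^ (1 / ((q : ℝ) - 1)) *
    (Real.exp 1 * p) ^ ((q : ℝ) / ((q : ℝ) - 1)) / q with hK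
  have hpow : (d : ℝ) ^ ((q : ℝ) / ((q : ℝ) - 1)) = (d : ℝ) ^ (1 / ((q : ℝ) - 1)) * d := by
    have hq1 : (q : ℝ) - 1 ≠ 0 := by
      have : (2 : ℝ) ≤ q := by exact_mod_cast hq
      linarith
    rw [← Real.rpow_add_one hd0.ne']
    congr 1
    field_simp
    ring
  set M : ℝ := max (K * (d : ℝ) ^ (1 / ((q : ℝ) - 1)) + 1) (2 * (p : ℝ) ^ 2) with hM
  have hMp : 2 * (p : ℝ) ^ 2 ≤ M := le_max_right _ _
  have hM0 : 0 < M := lt_of_lt_of_le (by positivity) hMp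
  have hgoal : max (K * (d : ℝ) ^ ((q : ℝ) / ((q : ℝ) - 1)) + d) (2 * (p : ℝ) ^ 2 * d) = M * d := by
    rw [hM, max_mul_of_nonneg _ _ hd0.le, hpow]
    congr 1
    ring
  rw [hgoal]
  have hHne : Nonempty H := by
    obtain ⟨h, hh⟩ := Finset.card_pos.1 (by omega : 0 < H.card)
    exact ⟨⟨h, hh⟩⟩
  rcases exists_row_or_column_strategy (fun (h : H) v => if v ∈ h.1 then (1 : ℝ) else 0) M⁻¹ with
    ⟨μ, hμ0, hμ1, hμ⟩ | ⟨w, hw0, hw1, hw⟩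
  · exfalso
    simp only [mul_ite, mul_one, mul_zero] at hμ
    have henum : ∀ h : H, ∃ t : Fin d → V, ∀ y, IsTop π h.1 y → ∃ c, t c = y := by
      intro h
      have hle := htop h h.2
      obtain ⟨v, hv⟩ := hne h h.2
      set s := (Set.toFinite {y | IsTop π h.1 y}).toFinset with hs
      rw [Set.ncard_eq_toFinset_card _ (Set.toFinite _)] at hle
      refine ⟨fun c => if hc : (c : ℕ) < s.card then s.equivFin.symm ⟨c, hc⟩ else v,
        fun y hy => ?_⟩
      have hys : y ∈ s := by simpa [hs] using hy
      have hlt := (s.equivFin ⟨y, hys⟩).2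
      exact ⟨⟨_, hlt.trans_le hle⟩, by simp⟩
    choose t ht using henum
    have hineq := one_le_of_forall_injective hμ0 hμ1 (A := fun h : H => h.1)
      (fun h => hne h h.2) hμ (p := p) (q := q) t (by
        intro f hf
        have hf' : Function.Injective fun i => (f i : Set V) := Subtype.val_injective.comp hf
        obtain ⟨T, hT, hTq, v, hv⟩ := hprop (Finset.univ.image fun i => (f i : Set V))
          (by
            intro h hh
            obtain ⟨i, -, rfl⟩ := Finset.mem_image.1 hh
            exact (f i).2)
          (by rw [Finset.card_image_of_injective _ hf', Finset.card_univ, Fintype.card_fin])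
        obtain ⟨T', -, rfl⟩ := Finset.subset_image_iff.1 hT
        rw [Finset.card_image_of_injective _ hf'] at hTq
        have hv' : ∀ i ∈ T', v ∈ (f i : Set V) := by simpa using hv
        obtain ⟨i, hi, y, hy, hyT⟩ := exists_isTop_mem_of_common hπ
          (Finset.card_pos.1 (by omega)) hv'
        obtain ⟨c, rfl⟩ := ht (f i) y hy
        exact ⟨T', hTq, i, hi, c, hyT⟩)
    have hle := le_of_sampling_inequality hq (by omega) hMp hineq
    have hlt : K * (d : ℝ) ^ (1 / ((q : ℝ) - 1)) + 1 ≤ M := le_max_left _ _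
    linarith
  · obtain ⟨C, hC, hCd⟩ := exists_cover_of_weight hπ hne htop hw0 hw1 (inv_pos.2 hM0)
      (fun h hh => by simpa using (hw ⟨h, hh⟩).le)
    rw [← div_eq_mul_inv, div_le_iff₀ hM0, mul_comm] at hCd
    refine le_trans ?_ hCd
    have hle : vertexCoverNum H ≤ C.card := Nat.sInf_le ⟨C, rfl, hC⟩
    exact_mod_cast hle
end

section
/- Let G be a finite simple graph on vertex set V that admits a tree decomposition of width at most k, i.e., there exist a finite tree T and an assignment of a subset X_t ⊆ V with |X_t| ≤ k+1 to each vertex t of T such that (i) ⋃_t X_t = V, (ii) for every edge uv of G some X_t contains both u and v, and (iii) for every v ∈ V the set of vertices t of T with v ∈ X_t induces a connected subgraph of T. Let p ≥ q ≥ 2 and d ≥ 1 be integers and let H be a finite family of nonempty subsets of V, each inducing a subgraph of G with at most d connected components, with |H| ≥ p. If H satisfies the (p,q) property, then the covering number satisfies τ(H) ≤ (k+1) · max{ (2^{1/(q-1)} · (e·p)^{q/(q-1)} / q) · d^{q/(q-1)} + d , 2·p²·d }. -/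
/-- In a tree rooted at `r`, a vertex has at most one neighbour closer to the root. -/
lemma SimpleGraph.IsTree.eq_of_adj_of_dist_lt_s9 {W : Type*} {T : SimpleGraph W} (hT : T.IsTree)
    {r x y z : W} (hy : T.Adj x y) (hz : T.Adj x z) (hry : T.dist r y < T.dist r x)
    (hrz : T.dist r z < T.dist r x) : y = z := by
  classical
  obtain ⟨p, hp, -⟩ := hT.connected.exists_path_of_dist r x
  have key : ∀ w, T.Adj x w → T.dist r w < T.dist r x → w = p.penultimate := by
    intro w hw hlt
    obtain ⟨s, hs, hsl⟩ := hT.connected.exists_path_of_dist r w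
    refine hT.isAcyclic.eq_penultimate_of_adj_end hp hw
      (hT.isAcyclic.mem_support_of_ne_mem_support_of_adj_of_isPath hp hs hw fun hx => ?_)
    have h₁ := SimpleGraph.dist_le (s.takeUntil x hx)
    have h₂ := s.length_takeUntil_le_length hx
    omega
  rw [key y hy hry, key z hz hrz]

/-- From any vertex of a connected vertex set `A` of a rooted tree one descends inside `A`, each
step getting closer to the root, to a vertex `a` of `A` closest to the root. -/
lemma SimpleGraph.IsTree.reflTransGen_of_isMin {W : Type*} {T : SimpleGraph W} (hT : T.IsTree)
    (r : W) {A : Set W} (hA : (T.induce A).Preconnected) {a x : W} (ha : a ∈ A)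
    (hmin : ∀ y ∈ A, T.dist r a ≤ T.dist r y) (hx : x ∈ A) :
    Relation.ReflTransGen (fun y z => T.Adj y z ∧ T.dist r z < T.dist r y ∧ z ∈ A) x a := by
  obtain ⟨w⟩ := hA ⟨x, hx⟩ ⟨a, ha⟩
  suffices h : ∀ (u v : A), (T.induce A).Walk u v → (v : W) = a →
      Relation.ReflTransGen (fun y z => T.Adj y z ∧ T.dist r z < T.dist r y ∧ z ∈ A) (u : W) a from
    h _ _ w rfl
  intro u v w
  induction w with
  | nil => rintro rfl; exact .refl
  | @cons u u' v hadj w ih =>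
    intro hv
    have hadj' : T.Adj (u : W) u' := hadj
    rcases lt_or_gt_of_ne (hT.dist_ne_of_adj r hadj') with hlt | hlt
    · rcases (ih hv).cases_head with h | ⟨z, ⟨hz, hzlt, -⟩, hza⟩
      · have := hmin u u.2
        rw [h] at hlt
        omega
      · rwa [hT.eq_of_adj_of_dist_lt_s9 hadj'.symm hz hlt hzlt]
    · exact .head ⟨hadj', hlt, u'.2⟩ (ih hv)

/-- If two connected vertex sets of a rooted tree meet, then the one whose vertex `a` closest to
the root is the nearer one contains the vertex closest to the root of the other. -/
lemma SimpleGraph.IsTree.mem_of_dist_le {W : Type*} {T : SimpleGraph W} (hT : T.IsTree)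
    (r : W) {A B : Set W} (hA : (T.induce A).Preconnected) (hB : (T.induce B).Preconnected)
    {a b x : W} (ha : a ∈ A) (hamin : ∀ y ∈ A, T.dist r a ≤ T.dist r y)
    (hb : b ∈ B) (hbmin : ∀ y ∈ B, T.dist r b ≤ T.dist r y)
    (hxA : x ∈ A) (hxB : x ∈ B) (hab : T.dist r a ≤ T.dist r b) : b ∈ A := by
  have hxa := hT.reflTransGen_of_isMin r hA ha hamin hxA
  have hxb := hT.reflTransGen_of_isMin r hB hb hbmin hxB
  have hmono : ∀ {y}, Relation.ReflTransGen
      (fun y z => T.Adj y z ∧ T.dist r z < T.dist r y ∧ z ∈ B) y b → T.dist r b ≤ T.dist r y := by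
    intro y hy
    induction hy using Relation.ReflTransGen.head_induction_on with
    | refl => exact le_rfl
    | head h _ ih => exact ih.trans h.2.1.le
  induction hxb using Relation.ReflTransGen.head_induction_on with
  | refl => exact hxA
  | @head x y h hyb ih =>
    rcases hxa.cases_head with rfl | ⟨z, ⟨hz, hzlt, hzA⟩, hza⟩
    · have := hmono hyb
      have := h.2.1
      omega
    · obtain rfl := hT.eq_of_adj_of_dist_lt_s9 h.1 hz h.2.1 hzlt
      exact ih hzA h.2.2 hza

/-- A min-max form of linear programming duality: if every mixed strategy of the row player can be
answered by a column of value at least `c`, then some mixed strategy of the column player has value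
at least `c` against every row. -/
lemma exists_mem_stdSimplex_forall_le_sum {ι W : Type*} [Fintype ι] [Fintype W] [Nonempty ι]
    [Nonempty W] (A : ι → W → ℝ) (c : ℝ)
    (h : ∀ u ∈ stdSimplex ℝ ι, ∃ t, c ≤ ∑ i, u i * A i t) :
    ∃ y ∈ stdSimplex ℝ W, ∀ i, c ≤ ∑ t, A i t * y t := by
  classical
  let B : (ι → ℝ) →ₗ[ℝ] (W → ℝ) →ₗ[ℝ] ℝ := Matrix.toLinearMap₂' ℝ (Matrix.of A)
  have hB : ∀ x y, B x y = ∑ i, ∑ t, x i * A i t * y t := by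
    intro x y
    simp only [B, Matrix.toLinearMap₂'_apply, smul_eq_mul, Matrix.of_apply]
    exact Finset.sum_congr rfl fun i _ => Finset.sum_congr rfl fun t _ => by ring
  obtain ⟨a, ha, b, hb, hab⟩ := Sion.exists_isSaddlePointOn (X := stdSimplex ℝ ι)
    (Y := stdSimplex ℝ W) (f := fun x y => B x y)
    ⟨_, single_mem_stdSimplex ℝ (Classical.arbitrary ι)⟩ (convex_stdSimplex ℝ ι)
    (isCompact_stdSimplex ℝ ι)
    (fun y _ => by
      simp only [hB]
      exact (Continuous.lowerSemicontinuous (by fun_prop)).lowerSemicontinuousOn _)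
    (fun y _ => ((B.flip y).convexOn (convex_stdSimplex ℝ ι)).quasiconvexOn)
    (convex_stdSimplex ℝ W)
    ⟨_, single_mem_stdSimplex ℝ (Classical.arbitrary W)⟩
    (isCompact_stdSimplex ℝ W)
    (fun x _ => by
      simp only [hB]
      exact (Continuous.upperSemicontinuous (by fun_prop)).upperSemicontinuousOn _)
    (fun x _ => ((B x).concaveOn (convex_stdSimplex ℝ W)).quasiconcaveOn)
  obtain ⟨t, ht⟩ := h a ha
  refine ⟨b, hb, fun i => ?_⟩
  have := hab _ (single_mem_stdSimplex ℝ i) _ (single_mem_stdSimplex ℝ t)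
  simp only [hB, Pi.single_apply, mul_ite, ite_mul, mul_one, mul_zero, one_mul, zero_mul,
    Finset.sum_ite_eq', Finset.mem_univ, if_true] at this
  exact ht.trans (by simpa using this)

/-- Suppose that whenever `S i` and `S j` meet, the one whose top is nearer contains the top of the
other. Then every finite subfamily is hit by the tops of pairwise disjoint members. -/
lemma exists_pairwiseDisjoint_hitting {κ W : Type*} (S : κ → Set W) (top : κ → W) (dep : W → ℕ)
    (htop : ∀ i, top i ∈ S i)
    (hmeet : ∀ i j x, x ∈ S i → x ∈ S j → dep (top i) ≤ dep (top j) → top j ∈ S i)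
    (F : Finset κ) :
    ∃ P ⊆ F, (P : Set κ).PairwiseDisjoint S ∧ ∀ i ∈ F, ∃ j ∈ P, top j ∈ S i := by
  classical
  induction F using Finset.strongInduction with
  | H F ih =>
    rcases F.eq_empty_or_nonempty with rfl | hF
    · exact ⟨∅, by simp⟩
    obtain ⟨j, hj, hmax⟩ := F.exists_max_image (fun i => dep (top i)) hF
    obtain ⟨P, hPF, hP, hhit⟩ := ih (F.filter fun i => top j ∉ S i)
      (Finset.filter_ssubset.2 ⟨j, hj, by simpa using htop j⟩)
    refine ⟨insert j P, ?_, ?_, ?_⟩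
    · exact Finset.insert_subset hj (hPF.trans (Finset.filter_subset _ _))
    · rw [Finset.coe_insert]
      refine hP.insert fun i hi _ => Set.disjoint_left.2 fun x hxj hxi => ?_
      have hi' := Finset.mem_filter.1 (hPF hi)
      exact hi'.2 (hmeet i j x hxi hxj (hmax i hi'.1))
    · intro i hi
      by_cases hji : top j ∈ S i
      · exact ⟨j, by simp, hji⟩
      · obtain ⟨l, hl, hli⟩ := hhit i (Finset.mem_filter.2 ⟨hi, hji⟩)
        exact ⟨l, by simp [hl], hli⟩

open Finset in
/-- Sampling `p` members independently with probabilities `u`: either two samples agree, or `q` of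
them contain a distinguished point of one of these `q`. -/
lemma one_le_add_of_forall_injective {ι W : Type*} [Fintype ι] (κ : ι → Type*)
    [∀ i, Fintype (κ i)] {p q d : ℕ} (hκ : ∀ i, Fintype.card (κ i) ≤ d) (u : ι → ℝ)
    (hu : u ∈ stdSimplex ℝ ι) (S : ι → Set W) [∀ t, DecidablePred fun i => t ∈ S i]
    (top : ∀ i, κ i → W) {m : ℝ} (hm : ∀ t, ∑ i with t ∈ S i, u i ≤ m) (hum : ∀ i, u i ≤ m)
    (hpq : ∀ f : Fin p → ι, Function.Injective f → ∃ I : Finset (Fin p), #I = q ∧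
      ∃ i ∈ I, ∃ K : κ (f i), ∀ j ∈ I, top (f i) K ∈ S (f j)) :
    1 ≤ (p : ℝ) ^ 2 * m + p.choose q * q * d * m ^ (q - 1) := by
  classical
  have hu0 := hu.1
  have hu1 : ∑ i, u i = 1 := hu.2
  have hι : Nonempty ι := by
    by_contra h
    rw [not_nonempty_iff] at h
    simp at hu1
  have hm0 : 0 ≤ m := (hu0 (Classical.arbitrary ι)).trans (hum _)
  let g : Fin p → Fin p → ι → Fin p → ι → ℝ := fun i j h l h' =>
    if l = i ∨ l = j then (if h' = h then u h' else 0) else u h'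
  let w : Finset (Fin p) → Fin p → ι → W → Fin p → ι → ℝ := fun I i h t l h' =>
    if l = i then (if h' = h then u h' else 0)
    else if l ∈ I then (if t ∈ S h' then u h' else 0) else u h'
  have hg0 : ∀ i j h l h', 0 ≤ g i j h l h' := by
    intro i j h l h'
    have := hu0 h'
    simp only [g]
    split_ifs <;> simp [this]
  have hw0 : ∀ I i h t l h', 0 ≤ w I i h t l h' := by
    intro I i h t l h'
    have := hu0 h'
    simp only [w]
    split_ifs <;> simp [this]
  have hpt : ∀ f : Fin p → ι, ∏ l, u (f l) ≤
      ∑ ij ∈ (univ : Finset (Fin p)).offDiag, ∑ h, ∏ l, g ij.1 ij.2 h l (f l) +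
      ∑ I ∈ powersetCard q univ, ∑ i ∈ I, ∑ h, ∑ K : κ h, ∏ l, w I i h (top h K) l (f l) := by
    intro f
    have hA : 0 ≤ ∑ ij ∈ (univ : Finset (Fin p)).offDiag, ∑ h, ∏ l, g ij.1 ij.2 h l (f l) :=
      sum_nonneg fun _ _ => sum_nonneg fun _ _ => prod_nonneg fun _ _ => hg0 _ _ _ _ _
    have hB : 0 ≤ ∑ I ∈ powersetCard q univ, ∑ i ∈ I, ∑ h, ∑ K : κ h,
        ∏ l, w I i h (top h K) l (f l) :=
      sum_nonneg fun _ _ => sum_nonneg fun _ _ => sum_nonneg fun _ _ => sum_nonneg fun _ _ =>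
        prod_nonneg fun _ _ => hw0 _ _ _ _ _ _
    by_cases hf : Function.Injective f
    · obtain ⟨I, hI, i, hi, K, hK⟩ := hpq f hf
      refine le_trans ?_ (le_add_of_nonneg_left hA)
      calc ∏ l, u (f l) = ∏ l, w I i (f i) (top (f i) K) l (f l) := by
            refine prod_congr rfl fun l _ => ?_
            simp only [w]
            split_ifs with h₁ h₂ h₃ h₄
            · rfl
            · exact absurd (congrArg f h₁) h₂
            · rfl
            · exact absurd (hK l h₃) h₄
            · rfl
        _ ≤ ∑ K : κ (f i), ∏ l, w I i (f i) (top (f i) K) l (f l) :=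
            single_le_sum (f := fun K => ∏ l, w I i (f i) (top (f i) K) l (f l))
              (fun _ _ => prod_nonneg fun _ _ => hw0 _ _ _ _ _ _) (mem_univ K)
        _ ≤ ∑ h, ∑ K : κ h, ∏ l, w I i h (top h K) l (f l) :=
            single_le_sum (f := fun h => ∑ K : κ h, ∏ l, w I i h (top h K) l (f l))
              (fun _ _ => sum_nonneg fun _ _ => prod_nonneg fun _ _ => hw0 _ _ _ _ _ _)
              (mem_univ (f i))
        _ ≤ ∑ i ∈ I, ∑ h, ∑ K : κ h, ∏ l, w I i h (top h K) l (f l) :=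
            single_le_sum (f := fun i => ∑ h, ∑ K : κ h, ∏ l, w I i h (top h K) l (f l))
              (fun _ _ => sum_nonneg fun _ _ => sum_nonneg fun _ _ =>
                prod_nonneg fun _ _ => hw0 _ _ _ _ _ _) hi
        _ ≤ _ :=
            single_le_sum (f := fun I => ∑ i ∈ I, ∑ h, ∑ K : κ h, ∏ l, w I i h (top h K) l (f l))
              (fun _ _ => sum_nonneg fun _ _ => sum_nonneg fun _ _ => sum_nonneg fun _ _ =>
                prod_nonneg fun _ _ => hw0 _ _ _ _ _ _) (by simp [mem_powersetCard, hI])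
    · simp only [Function.Injective, not_forall] at hf
      obtain ⟨i, j, hij, hne⟩ := hf
      refine le_trans ?_ (le_add_of_nonneg_right hB)
      calc ∏ l, u (f l) = ∏ l, g i j (f i) l (f l) := by
            refine prod_congr rfl fun l _ => ?_
            simp only [g]
            split_ifs with h₁ h₂
            · rfl
            · rcases h₁ with rfl | rfl
              · exact absurd rfl h₂
              · exact absurd hij.symm h₂
            · rfl
        _ ≤ ∑ h, ∏ l, g i j h l (f l) :=
            single_le_sum (f := fun h => ∏ l, g i j h l (f l))
              (fun _ _ => prod_nonneg fun _ _ => hg0 _ _ _ _ _) (mem_univ (f i))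
        _ ≤ _ :=
            single_le_sum (f := fun ij : Fin p × Fin p => ∑ h, ∏ l, g ij.1 ij.2 h l (f l))
              (fun _ _ => sum_nonneg fun _ _ => prod_nonneg fun _ _ => hg0 _ _ _ _ _)
              (a := (i, j)) (by simp [hne])
  have hprod : ∀ F : Fin p → ι → ℝ, ∑ f : Fin p → ι, ∏ l, F l (f l) = ∏ l, ∑ h, F l h := by
    intro F
    rw [prod_univ_sum, Fintype.piFinset_univ]
  have hgsum : ∀ i j, i ≠ j → ∑ h, ∑ f : Fin p → ι, ∏ l, g i j h l (f l) ≤ m := by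
    intro i j hij
    have hle : ∀ h, ∑ f : Fin p → ι, ∏ l, g i j h l (f l) ≤ u h * m := by
      intro h
      rw [hprod, ← mul_prod_erase univ _ (mem_univ i),
        ← mul_prod_erase (univ.erase i) _ (mem_erase.2 ⟨hij.symm, mem_univ j⟩)]
      rw [prod_eq_one (s := (univ.erase i).erase j)]
      · simpa [g] using mul_le_mul_of_nonneg_left (hum h) (hu0 h)
      · intro l hl
        simp only [mem_erase, mem_univ, and_true] at hl
        simp [g, hl.1, hl.2, hu1]
    calc _ ≤ ∑ h, u h * m := sum_le_sum fun h _ => hle h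
      _ = m := by rw [← sum_mul, hu1, one_mul]
  have hwsum : ∀ I : Finset (Fin p), #I = q → ∀ i ∈ I, ∑ h, ∑ K : κ h, ∑ f : Fin p → ι,
      ∏ l, w I i h (top h K) l (f l) ≤ d * m ^ (q - 1) := by
    intro I hI i hi
    have hle : ∀ h t, ∑ f : Fin p → ι, ∏ l, w I i h t l (f l) ≤ u h * m ^ (q - 1) := by
      intro h t
      rw [hprod, ← mul_prod_erase univ _ (mem_univ i)]
      have h₁ : ∑ h', w I i h t i h' = u h := by simp [w]
      rw [h₁]
      refine mul_le_mul_of_nonneg_left ?_ (hu0 h)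
      have h₂ : ∏ l ∈ univ.erase i, ∑ h', w I i h t l h' =
          ∏ l ∈ I.erase i, ∑ h', w I i h t l h' := by
        refine (prod_subset (erase_subset_erase _ (subset_univ I)) fun l hl hl' => ?_).symm
        simp only [mem_erase, mem_univ, and_true] at hl
        have : l ∉ I := fun h => hl' (mem_erase.2 ⟨hl, h⟩)
        simp [w, hl, this, hu1]
      rw [h₂, ← hI, ← card_erase_of_mem hi, ← prod_const]
      refine prod_le_prod (fun l _ => sum_nonneg fun _ _ => hw0 _ _ _ _ _ _) fun l hl => ?_
      simp only [mem_erase] at hl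
      simpa [w, hl.1, hl.2, sum_filter] using hm t
    calc _ ≤ ∑ h, ∑ K : κ h, u h * m ^ (q - 1) :=
          sum_le_sum fun h _ => sum_le_sum fun K _ => hle h _
      _ ≤ ∑ h, u h * (d * m ^ (q - 1)) := by
          refine sum_le_sum fun h _ => ?_
          rw [sum_const, nsmul_eq_mul, card_univ]
          have h₁ : (Fintype.card (κ h) : ℝ) ≤ d := by exact_mod_cast hκ h
          have h₂ : 0 ≤ u h * m ^ (q - 1) := mul_nonneg (hu0 h) (pow_nonneg hm0 _)
          nlinarith [mul_le_mul_of_nonneg_right h₁ h₂]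
      _ = d * m ^ (q - 1) := by rw [← sum_mul, hu1, one_mul]
  calc (1 : ℝ) = ∑ f : Fin p → ι, ∏ l, u (f l) := by
        rw [hprod fun _ => u]; simp [hu1]
    _ ≤ _ := sum_le_sum fun f _ => hpt f
    _ = ∑ ij ∈ (univ : Finset (Fin p)).offDiag,
          ∑ h, ∑ f : Fin p → ι, ∏ l, g ij.1 ij.2 h l (f l) +
        ∑ I ∈ powersetCard q univ, ∑ i ∈ I, ∑ h, ∑ K : κ h, ∑ f : Fin p → ι,
          ∏ l, w I i h (top h K) l (f l) := by
        rw [sum_add_distrib]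
        congr 1
        · rw [sum_comm]
          exact sum_congr rfl fun _ _ => sum_comm
        · rw [sum_comm]
          refine sum_congr rfl fun I _ => ?_
          rw [sum_comm]
          refine sum_congr rfl fun i _ => ?_
          rw [sum_comm]
          exact sum_congr rfl fun h _ => sum_comm
    _ ≤ ∑ ij ∈ (univ : Finset (Fin p)).offDiag, m +
        ∑ I ∈ powersetCard q (univ : Finset (Fin p)), ∑ i ∈ I, (d : ℝ) * m ^ (q - 1) := by
        refine add_le_add (sum_le_sum fun ij hij => hgsum _ _ (mem_offDiag.1 hij).2.2)
          (sum_le_sum fun I hI => sum_le_sum fun i hi => hwsum I (mem_powersetCard.1 hI).2 i hi)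
    _ ≤ _ := by
        have h₁ : ∑ I ∈ powersetCard q (univ : Finset (Fin p)), ∑ i ∈ I, (d : ℝ) * m ^ (q - 1) =
            p.choose q * q * d * m ^ (q - 1) := by
          rw [sum_congr rfl fun I hI => by
            rw [sum_const, (mem_powersetCard.1 hI).2], sum_const, card_powersetCard, card_univ,
            Fintype.card_fin, nsmul_eq_mul, nsmul_eq_mul]
          ring
        rw [h₁, sum_const, offDiag_card, card_univ, Fintype.card_fin, nsmul_eq_mul]
        gcongr
        rw [sq]
        exact_mod_cast Nat.sub_le _ _

/-- If `v` ranges over a connected component of `G.induce h`, then the nodes of the tree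
decomposition whose bags contain some such `v` form a connected set. -/
lemma preconnected_induce_bags_connectedComponent {V W : Type*} {G : SimpleGraph V}
    {T : SimpleGraph W} {X : W → Finset V}
    (hedges : ∀ u v : V, G.Adj u v → ∃ t : W, u ∈ X t ∧ v ∈ X t)
    (hconn : ∀ v : V, (T.induce {t : W | v ∈ X t}).Connected)
    {h : Set V} (K : (G.induce h).ConnectedComponent) :
    (T.induce {t | ∃ v : h, (G.induce h).connectedComponentMk v = K ∧
      (v : V) ∈ X t}).Preconnected := by
  set A : Set W := {t | ∃ v : h, (G.induce h).connectedComponentMk v = K ∧ (v : V) ∈ X t}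
    with hA
  have hbag : ∀ v : h, (G.induce h).connectedComponentMk v = K → ∀ t t' : A,
      (v : V) ∈ X t → (v : V) ∈ X t' → (T.induce A).Reachable t t' := by
    intro v hv t t' ht ht'
    have hle : {t : W | (v : V) ∈ X t} ⊆ A := fun s hs => ⟨v, hv, hs⟩
    exact ((hconn v).preconnected ⟨t, ht⟩ ⟨t', ht'⟩).map (T.induceHomOfLE hle).toHom
  have hwalk : ∀ v v' : h, (G.induce h).Walk v v' → (G.induce h).connectedComponentMk v = K →
      ∀ t t' : A, (v : V) ∈ X t → (v' : V) ∈ X t' → (T.induce A).Reachable t t' := by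
    intro v v' w
    induction w with
    | nil => exact hbag _
    | @cons v v₁ v' hadj w ih =>
      intro hv t t' ht ht'
      obtain ⟨s, hs, hs₁⟩ := hedges v v₁ hadj
      have hv₁ : (G.induce h).connectedComponentMk v₁ = K := by
        rw [← hv]
        exact SimpleGraph.ConnectedComponent.sound hadj.symm.reachable
      exact (hbag v hv t ⟨s, v, hv, hs⟩ ht hs).trans (ih hv₁ ⟨s, v, hv, hs⟩ t' hs₁ ht')
  rintro ⟨t, v, hv, ht⟩ ⟨t', v', hv', ht'⟩
  obtain ⟨w⟩ := SimpleGraph.ConnectedComponent.exact (hv.trans hv'.symm)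
  exact hwalk v v' w hv _ _ ht ht'

/-- `p.choose q ≤ (e * p / q) ^ q`, without denominators. -/
lemma choose_mul_pow_le_exp_mul_pow (p q : ℕ) :
    (p.choose q : ℝ) * (q : ℝ) ^ q ≤ (Real.exp 1 * p) ^ q := by
  have h₁ : (p.choose q : ℝ) ≤ (p : ℝ) ^ q / q.factorial := Nat.choose_le_pow_div q p
  have h₂ : (q : ℝ) ^ q / q.factorial ≤ Real.exp 1 ^ q := by
    rw [← Real.exp_nat_mul, mul_one]
    exact Real.pow_div_factorial_le_exp _ (Nat.cast_nonneg q) q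
  calc (p.choose q : ℝ) * (q : ℝ) ^ q ≤ (p : ℝ) ^ q / q.factorial * (q : ℝ) ^ q := by gcongr
    _ = (p : ℝ) ^ q * ((q : ℝ) ^ q / q.factorial) := by ring
    _ ≤ (p : ℝ) ^ q * Real.exp 1 ^ q := by gcongr
    _ = (Real.exp 1 * p) ^ q := by ring

/-- The numerical bound extracted from the sampling inequality. -/
lemma le_max_mul_of_one_le_add {p q d : ℕ} (hq : 2 ≤ q) (hd : 1 ≤ d) {m : ℝ}
    (hm : 0 ≤ m) (h : 1 ≤ (p : ℝ) ^ 2 * m + p.choose q * q * d * m ^ (q - 1)) :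
    (d : ℝ) ≤ max
      ((2 : ℝ) ^ (1 / ((q : ℝ) - 1)) * (Real.exp 1 * p) ^ ((q : ℝ) / ((q : ℝ) - 1)) / q
        * (d : ℝ) ^ ((q : ℝ) / ((q : ℝ) - 1)) + d)
      (2 * (p : ℝ) ^ 2 * d) * m := by
  by_contra! hlt
  obtain ⟨n, rfl⟩ : ∃ n, q = n + 1 := ⟨q - 1, by omega⟩
  have hn : n ≠ 0 := by omega
  have hn' : (n : ℝ) ≠ 0 := by exact_mod_cast hn
  have hd0 : (0 : ℝ) < d := by exact_mod_cast hd
  have hroot : ∀ x : ℝ, 0 ≤ x → (x ^ (1 / (n : ℝ))) ^ n = x := by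
    intro x hx
    rw [one_div, Real.rpow_inv_natCast_pow hx hn]
  have hpow : ∀ x : ℝ, 0 ≤ x → (x ^ (((n + 1 : ℕ) : ℝ) / (n : ℝ))) ^ n = x ^ (n + 1) := by
    intro x hx
    rw [← Real.rpow_natCast, ← Real.rpow_mul hx, div_mul_cancel₀ _ hn', Real.rpow_natCast]
  have hcast : ((n + 1 : ℕ) : ℝ) - 1 = n := by push_cast; ring
  rw [hcast] at hlt
  rw [Nat.add_sub_cancel] at h
  set a : ℝ := (2 : ℝ) ^ (1 / (n : ℝ)) with ha
  set b : ℝ := (Real.exp 1 * p) ^ (((n + 1 : ℕ) : ℝ) / (n : ℝ)) with hb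
  set c : ℝ := (d : ℝ) ^ (((n + 1 : ℕ) : ℝ) / (n : ℝ)) with hc
  have ha0 : 0 ≤ a := by positivity
  have hb0 : 0 ≤ b := by positivity
  have hc0 : 0 ≤ c := by positivity
  have han : a ^ n = 2 := hroot 2 (by norm_num)
  have hbn : b ^ n = (Real.exp 1 * p) ^ (n + 1) := hpow _ (by positivity)
  have hcn : c ^ n = (d : ℝ) ^ (n + 1) := hpow _ (by positivity)
  have h₁ : (p : ℝ) ^ 2 * m < 1 / 2 := by
    have := (mul_le_mul_of_nonneg_right (le_max_right _ _) hm).trans_lt hlt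
    have : 2 * ((p : ℝ) ^ 2 * m) * d < 1 * d := by linarith
    have := lt_of_mul_lt_mul_right this hd0.le
    linarith
  have h₂ : a * b * c * m < d * (n + 1 : ℕ) := by
    have h₃ := (mul_le_mul_of_nonneg_right (le_max_left _ _) hm).trans_lt hlt
    have h₄ : a * b / (n + 1 : ℕ) * c * m < d := by nlinarith
    have h₅ : a * b / (n + 1 : ℕ) * c * m = a * b * c * m / (n + 1 : ℕ) := by ring
    rwa [h₅, div_lt_iff₀ (by positivity)] at h₄
  have h₃ : 2 * (Real.exp 1 * p) ^ (n + 1) * (d * m ^ n) < ((n + 1 : ℕ) : ℝ) ^ n := by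
    have := pow_lt_pow_left₀ h₂ (by positivity) hn
    rw [mul_pow, mul_pow, mul_pow, mul_pow, han, hbn, hcn, pow_succ (d : ℝ)] at this
    refine lt_of_mul_lt_mul_left (a := (d : ℝ) ^ n) ?_ (by positivity)
    linarith
  have h₄ : (p.choose (n + 1) : ℝ) * (n + 1 : ℕ) * d * m ^ n < 1 / 2 := by
    have h₅ := mul_le_mul_of_nonneg_right (choose_mul_pow_le_exp_mul_pow p (n + 1))
      (show 0 ≤ d * m ^ n by positivity)
    rw [pow_succ ((n + 1 : ℕ) : ℝ)] at h₅
    refine lt_of_mul_lt_mul_left (a := ((n + 1 : ℕ) : ℝ) ^ n) ?_ (by positivity)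
    linarith
  linarith

theorem treewidth_cover_of_pq_property {V : Type*} [Fintype V]
    (G : SimpleGraph V) (k : ℕ)
    -- a tree decomposition of `G` of width at most `k`:
    {W : Type*} [Fintype W] (T : SimpleGraph W) (hT : T.IsTree)
    (X : W → Finset V)
    (hwidth : ∀ t : W, (X t).card ≤ k + 1)
    (hcoverV : ∀ v : V, ∃ t : W, v ∈ X t)
    (hedges : ∀ u v : V, G.Adj u v → ∃ t : W, u ∈ X t ∧ v ∈ X t)
    (hconn : ∀ v : V, (T.induce {t : W | v ∈ X t}).Connected)
    (p q d : ℕ) (hq : 2 ≤ q) (hqp : q ≤ p) (hd : 1 ≤ d)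
    (H : Finset (Set V)) (hne : ∀ h ∈ H, h.Nonempty)
    (hcomp : ∀ h ∈ H, Nat.card (G.induce h).ConnectedComponent ≤ d)
    (hcard : p ≤ H.card)
    (hprop : VertexPQProperty H p q) :
    (vertexCoverNum H : ℝ) ≤ ((k : ℝ) + 1) * max
      ((2 : ℝ) ^ (1 / ((q : ℝ) - 1)) * (Real.exp 1 * p) ^ ((q : ℝ) / ((q : ℝ) - 1)) / q
        * (d : ℝ) ^ ((q : ℝ) / ((q : ℝ) - 1)) + d)
      (2 * (p : ℝ) ^ 2 * d) := by
  classical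
  set R : ℝ := max
      ((2 : ℝ) ^ (1 / ((q : ℝ) - 1)) * (Real.exp 1 * p) ^ ((q : ℝ) / ((q : ℝ) - 1)) / q
        * (d : ℝ) ^ ((q : ℝ) / ((q : ℝ) - 1)) + d)
      (2 * (p : ℝ) ^ 2 * d) with hR
  have hp0 : (0 : ℝ) < p := by exact_mod_cast (by omega : 0 < p)
  have hd0 : (0 : ℝ) < d := by exact_mod_cast hd
  have hR0 : 0 < R := lt_of_lt_of_le (by positivity) (le_max_right _ _)
  have : Nonempty W := hT.connected.nonempty
  have : Nonempty H := by
    obtain ⟨h, hh⟩ := Finset.card_pos.1 (show 0 < H.card by omega)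
    exact ⟨⟨h, hh⟩⟩
  let r : W := Classical.arbitrary W
  let κ : H → Type _ := fun h => (G.induce (h : Set V)).ConnectedComponent
  let : ∀ h, Fintype (κ h) := fun h => Fintype.ofFinite _
  let S : H → Set W := fun h => {t | ∃ v ∈ (h : Set V), v ∈ X t}
  let C : ∀ h, κ h → Set W := fun h K =>
    {t | ∃ v : (h : Set V), (G.induce (h : Set V)).connectedComponentMk v = K ∧ (v : V) ∈ X t}
  have hCS : ∀ h K, C h K ⊆ S h := fun h K t ⟨v, _, hv⟩ => ⟨v, v.2, hv⟩
  have hCconn : ∀ h K, (T.induce (C h K)).Preconnected := fun h K =>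
    preconnected_induce_bags_connectedComponent hedges hconn K
  have hCne : ∀ h K, (C h K).Nonempty := by
    intro h K
    obtain ⟨v, rfl⟩ := K.exists_rep
    obtain ⟨t, ht⟩ := hcoverV v
    exact ⟨t, v, rfl, ht⟩
  choose top htop hmin using fun h K =>
    Set.exists_min_image (C h K) (T.dist r) (Set.toFinite _) (hCne h K)
  have hmeet : ∀ h K h' K' x, x ∈ C h K → x ∈ C h' K' →
      T.dist r (top h K) ≤ T.dist r (top h' K') → top h' K' ∈ C h K :=
    fun h K h' K' x hx hx' hle => hT.mem_of_dist_le r (hCconn h K) (hCconn h' K') (htop h K)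
      (hmin h K) (htop h' K') (hmin h' K') hx hx' hle
  have hpoint : ∀ f : Fin p → H, Function.Injective f → ∃ I : Finset (Fin p), I.card = q ∧
      ∃ i ∈ I, ∃ K : κ (f i), ∀ j ∈ I, top (f i) K ∈ S (f j) := by
    intro f hf
    have hf' : Function.Injective fun i => (f i : Set V) := Subtype.val_injective.comp hf
    obtain ⟨F, hFS, hFq, v, hv⟩ := hprop (Finset.univ.image fun i => (f i : Set V))
      (by simp [Finset.image_subset_iff])
      (by rw [Finset.card_image_of_injective _ hf', Finset.card_univ, Fintype.card_fin])
    obtain ⟨I, -, rfl⟩ := Finset.subset_image_iff.1 hFS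
    rw [Finset.card_image_of_injective _ hf'] at hFq
    have hvI : ∀ i ∈ I, v ∈ (f i : Set V) := fun i hi =>
      Set.mem_iInter₂.1 hv (f i) (Finset.mem_image_of_mem _ hi)
    obtain ⟨t, ht⟩ := hcoverV v
    let K : ∀ i : I, κ (f i) := fun i =>
      (G.induce (f i : Set V)).connectedComponentMk ⟨v, hvI i i.2⟩
    have htK : ∀ i : I, t ∈ C (f i) (K i) := fun i => ⟨⟨v, hvI i i.2⟩, rfl, ht⟩
    have : Nonempty I := by
      obtain ⟨i, hi⟩ := Finset.card_pos.1 (show 0 < I.card by omega)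
      exact ⟨⟨i, hi⟩⟩
    obtain ⟨i, hi⟩ := Finite.exists_max fun i : I => T.dist r (top (f i) (K i))
    exact ⟨I, hFq, i, i.2, K i, fun j hj =>
      hCS _ _ (hmeet _ (K ⟨j, hj⟩) _ _ t (htK ⟨j, hj⟩) (htK i) (hi ⟨j, hj⟩))⟩
  have hdual : ∀ u ∈ stdSimplex ℝ H, ∃ t, d / R ≤ ∑ h, u h * if t ∈ S h then (1 : ℝ) else 0 := by
    intro u hu
    simp only [mul_ite, mul_one, mul_zero]
    obtain ⟨t, ht⟩ := Finite.exists_max fun t => ∑ h, if t ∈ S h then u h else 0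
    refine ⟨t, ?_⟩
    have hnn : ∀ s h, 0 ≤ if s ∈ S h then u h else 0 := fun s h => by
      split_ifs
      exacts [hu.1 h, le_rfl]
    rw [div_le_iff₀' hR0]
    refine le_max_mul_of_one_le_add hq hd (Finset.sum_nonneg fun h _ => hnn t h)
      (one_le_add_of_forall_injective κ (fun h => ?_) u hu S top (fun s => ?_) (fun h => ?_)
        hpoint)
    · rw [← Nat.card_eq_fintype_card]
      exact hcomp h h.2
    · rw [Finset.sum_filter]
      exact ht s
    · obtain ⟨v, hv⟩ := hne h h.2
      obtain ⟨s, hs⟩ := hcoverV v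
      have hsh : s ∈ S h := ⟨v, hv, hs⟩
      calc u h = if s ∈ S h then u h else 0 := by rw [if_pos hsh]
        _ ≤ ∑ h, if s ∈ S h then u h else 0 :=
            Finset.single_le_sum (f := fun h => if s ∈ S h then u h else 0)
              (fun h _ => hnn s h) (Finset.mem_univ h)
        _ ≤ _ := ht s
  obtain ⟨y, hy, hyS⟩ := exists_mem_stdSimplex_forall_le_sum _ _ hdual
  have hheavy : ∀ h, ∃ K : κ h, 1 / R ≤ ∑ t, if t ∈ C h K then y t else 0 := by
    intro h
    obtain ⟨v, hv⟩ := hne h h.2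
    have : Nonempty (κ h) := ⟨(G.induce (h : Set V)).connectedComponentMk ⟨v, hv⟩⟩
    have hcardR : (Fintype.card (κ h) : ℝ) ≤ d := by
      rw [← Nat.card_eq_fintype_card]
      exact_mod_cast hcomp h h.2
    obtain ⟨K, -, hK⟩ := Finset.exists_le_of_sum_le (s := (Finset.univ : Finset (κ h)))
      (f := fun _ => 1 / R) (g := fun K => ∑ t, if t ∈ C h K then y t else 0)
      Finset.univ_nonempty (by
        calc ∑ _K : κ h, 1 / R = Fintype.card (κ h) / R := by
              rw [Finset.sum_const, Finset.card_univ, nsmul_eq_mul, mul_one_div]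
          _ ≤ d / R := by gcongr
          _ ≤ ∑ t, (if t ∈ S h then 1 else 0) * y t := hyS h
          _ ≤ ∑ t, ∑ K : κ h, if t ∈ C h K then y t else 0 := by
              refine Finset.sum_le_sum fun t _ => ?_
              have hnn : ∀ K ∈ (Finset.univ : Finset (κ h)),
                  0 ≤ if t ∈ C h K then y t else 0 := fun K _ => by
                split_ifs
                exacts [hy.1 t, le_rfl]
              by_cases ht : t ∈ S h
              · obtain ⟨w, hw, hwt⟩ := ht
                have hmem : t ∈ C h ((G.induce (h : Set V)).connectedComponentMk ⟨w, hw⟩) :=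
                  ⟨⟨w, hw⟩, rfl, hwt⟩
                rw [if_pos ⟨w, hw, hwt⟩, one_mul]
                exact (if_pos hmem).ge.trans (Finset.single_le_sum hnn (Finset.mem_univ _))
              · rw [if_neg ht, zero_mul]
                exact Finset.sum_nonneg hnn
          _ = _ := Finset.sum_comm)
    exact ⟨K, hK⟩
  choose K hK using hheavy
  obtain ⟨P, -, hPdisj, hPhit⟩ := exists_pairwiseDisjoint_hitting (fun h => C h (K h))
    (fun h => top h (K h)) (T.dist r) (fun h => htop h _)
    (fun h h' x hx hx' hle => hmeet _ _ _ _ x hx hx' hle) Finset.univ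
  have hPR : (P.card : ℝ) ≤ R := by
    have h₁ : P.card * (1 / R) ≤ 1 := by
      calc P.card * (1 / R) = ∑ _h ∈ P, 1 / R := by rw [Finset.sum_const, nsmul_eq_mul]
        _ ≤ ∑ h ∈ P, ∑ t, if t ∈ C h (K h) then y t else 0 := Finset.sum_le_sum fun h _ => hK h
        _ = ∑ t, ∑ h ∈ P, if t ∈ C h (K h) then y t else 0 := Finset.sum_comm
        _ ≤ ∑ t, y t := by
            refine Finset.sum_le_sum fun t _ => ?_
            by_cases ht : ∃ h ∈ P, t ∈ C h (K h)
            · obtain ⟨h, hh, hth⟩ := ht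
              rw [Finset.sum_eq_single_of_mem h hh, if_pos hth]
              intro h' hh' hne'
              exact if_neg fun hth' => Set.disjoint_left.1 (hPdisj hh' hh hne') hth' hth
            · push Not at ht
              rw [Finset.sum_eq_zero fun h hh => if_neg (ht h hh)]
              exact hy.1 t
        _ = 1 := hy.2
    rwa [mul_one_div, div_le_one hR0] at h₁
  have hcov : vertexCoverNum H ≤ (P.biUnion fun h => X (top h (K h))).card := by
    refine Nat.sInf_le ⟨_, rfl, fun h hh => ?_⟩
    obtain ⟨j, hj, v, -, hv⟩ := hPhit ⟨h, hh⟩ (Finset.mem_univ _)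
    exact ⟨v, Finset.mem_biUnion.2 ⟨j, hj, hv⟩, v.2⟩
  have hbound : vertexCoverNum H ≤ P.card * (k + 1) :=
    hcov.trans (Finset.card_biUnion_le_card_mul _ _ _ fun h _ => hwidth _)
  calc (vertexCoverNum H : ℝ) ≤ P.card * (k + 1) := by exact_mod_cast hbound
    _ ≤ R * (k + 1) := by gcongr
    _ = (k + 1) * R := mul_comm _ _
end

section
/- Let G be a finite tree, let d ≥ 1 be an integer, and let H be a finite family of nonempty subsets of the vertex set of G, each inducing a subgraph of G with at most d connected components. Then the covering number and the fractional covering number satisfy τ(H) ≤ d · τ*(H). -/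
open Finset

/-- Greedy covering: if every member `t` of `F` has a top vertex that belongs to each member
meeting `t` whose top is at most as deep, then sets of weight at least `ε` admit a small cover. -/
theorem exists_cover_card_mul_le_sum {V : Type*} [DecidableEq V] (w : V → ℝ) (hw : ∀ v, 0 ≤ w v)
    (ε : ℝ) (top : Finset V → V) (depth : V → ℕ) (F : Finset (Finset V))
    (htop : ∀ t ∈ F, top t ∈ t)
    (hmeet : ∀ s ∈ F, ∀ t ∈ F, ¬ Disjoint s t → depth (top s) ≤ depth (top t) → top t ∈ s)
    (hε : ∀ t ∈ F, ε ≤ ∑ v ∈ t, w v) :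
    ∃ C : Finset V, (C.card : ℝ) * ε ≤ ∑ v ∈ F.biUnion id, w v ∧ ∀ t ∈ F, ∃ v ∈ C, v ∈ t := by
  induction F using Finset.strongInduction with
  | H F ih =>
  rcases F.eq_empty_or_nonempty with rfl | hF
  · exact ⟨∅, by simp, by simp⟩
  obtain ⟨t, ht, hmax⟩ := F.exists_max_image (fun t => depth (top t)) hF
  set F' := F.filter (fun s => top t ∉ s) with hF'
  have hsub : F' ⊆ F := filter_subset _ _
  have hss : F' ⊂ F := by
    refine ⟨hsub, fun h => ?_⟩
    exact (mem_filter.1 (h ht)).2 (htop t ht)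
  obtain ⟨C, hC, hcov⟩ := ih F' hss (fun s hs => htop s (hsub hs))
    (fun s hs u hu => hmeet s (hsub hs) u (hsub hu)) (fun s hs => hε s (hsub hs))
  have hdisj : Disjoint (F'.biUnion id) t := by
    rw [disjoint_biUnion_left]
    intro s hs
    by_contra h
    exact (mem_filter.1 hs).2 (hmeet s (hsub hs) t ht h (hmax s (hsub hs)))
  have hsum : ∑ v ∈ F'.biUnion id, w v + ∑ v ∈ t, w v ≤ ∑ v ∈ F.biUnion id, w v := by
    rw [← sum_union hdisj]
    refine sum_le_sum_of_subset_of_nonneg ?_ (fun v _ _ => hw v)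
    exact union_subset (biUnion_subset_biUnion_of_subset_left _ hsub)
      (subset_biUnion_of_mem id ht)
  have hcover : ∀ s ∈ F, ∃ v ∈ insert (top t) C, v ∈ s := by
    intro s hs
    by_cases h : top t ∈ s
    · exact ⟨_, mem_insert_self _ _, h⟩
    · obtain ⟨v, hv, hvs⟩ := hcov s (mem_filter.2 ⟨hs, h⟩)
      exact ⟨v, mem_insert_of_mem hv, hvs⟩
  refine ⟨insert (top t) C, ?_, hcover⟩
  by_cases h : top t ∈ C
  · rw [insert_eq_of_mem h]
    linarith [sum_nonneg (s := t) fun v _ => hw v]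
  · rw [card_insert_of_notMem h]
    push_cast
    linarith [hε t ht]

/-- In a tree with paths `P y` from each `y` to the root `r`, the only edge leaving the set of
descendants of `b` joins `b` to a vertex that is closer to the root. -/
theorem SimpleGraph.IsAcyclic.eq_of_adj_of_mem_support {V : Type*} {G : SimpleGraph V}
    (hG : G.IsAcyclic) {r : V} (P : ∀ y, G.Walk y r) (hP : ∀ y, (P y).IsPath) {b y z : V}
    (hyz : G.Adj y z) (hy : b ∈ (P y).support) (hz : b ∉ (P z).support) :
    y = b ∧ (P z).length < (P b).length := by
  classical
  have huniq : ∀ {y} (p : G.Walk y r), p.IsPath → p = P y := fun {y} p hp =>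
    congrArg Subtype.val ((hG.subsingleton_path y r).elim ⟨p, hp⟩ ⟨P y, hP y⟩)
  by_cases h : y ∈ (P z).support
  · rw [← huniq _ ((hP z).dropUntil h)] at hy
    exact absurd ((P z).support_dropUntil_subset_support h hy) hz
  · have hcons := huniq (.cons hyz (P z)) ((hP z).cons h)
    rw [← hcons, Walk.support_cons, List.mem_cons] at hy
    obtain rfl := hy.resolve_right hz
    exact ⟨rfl, by rw [← hcons]; simp⟩

/-- A proper descendant of `b` is deeper than `b`. -/
theorem SimpleGraph.IsAcyclic.length_lt_of_mem_support {V : Type*} {G : SimpleGraph V}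
    (hG : G.IsAcyclic) {r : V} (P : ∀ y, G.Walk y r) (hP : ∀ y, (P y).IsPath) {b y : V}
    (hy : b ∈ (P y).support) (hne : y ≠ b) : (P b).length < (P y).length := by
  classical
  have h : (P y).dropUntil b hy = P b :=
    congrArg Subtype.val
      ((hG.subsingleton_path b r).elim ⟨_, (hP y).dropUntil hy⟩ ⟨P b, hP b⟩)
  have hlen := congrArg Walk.length ((P y).take_spec hy)
  rw [Walk.length_append, h] at hlen
  have hpos : 0 < ((P y).takeUntil b hy).length := by
    rw [Nat.pos_iff_ne_zero]
    exact fun h0 => hne (Walk.eq_of_length_eq_zero h0)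
  omega

/-- Two intersecting subtrees of a rooted tree: the deeper of the two tops lies in both. -/
theorem SimpleGraph.IsAcyclic.top_mem_of_inter {V : Type*} {G : SimpleGraph V}
    (hG : G.IsAcyclic) {r : V} (P : ∀ y, G.Walk y r) (hP : ∀ y, (P y).IsPath) {s t : Set V}
    (hs : ∀ x ∈ s, ∀ y ∈ s, ∃ p : G.Walk x y, ∀ v ∈ p.support, v ∈ s)
    (ht : ∀ x ∈ t, ∀ y ∈ t, ∃ p : G.Walk x y, ∀ v ∈ p.support, v ∈ t)
    {a b x : V} (ha : a ∈ s) (hb : b ∈ t) (hxs : x ∈ s) (hxt : x ∈ t)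
    (hbmin : ∀ y ∈ t, (P b).length ≤ (P y).length) (hab : (P a).length ≤ (P b).length) :
    b ∈ s := by
  let D : Set V := {y | b ∈ (P y).support}
  have hbD : b ∈ D := (P b).start_mem_support
  have hxD : x ∈ D := by
    by_contra hx
    obtain ⟨p, hp⟩ := ht b hb x hxt
    obtain ⟨e, he, h1, h2⟩ := p.exists_boundary_dart D hbD hx
    have := (hG.eq_of_adj_of_mem_support P hP e.adj h1 h2).2
    have := hbmin e.snd (hp _ (p.dart_snd_mem_support_of_mem_darts he))
    omega
  by_cases hab' : a = b
  · exact hab' ▸ ha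
  have haD : a ∉ D := fun h => by
    have := hG.length_lt_of_mem_support P hP h hab'
    omega
  obtain ⟨p, hp⟩ := hs x hxs a ha
  obtain ⟨e, he, h1, h2⟩ := p.exists_boundary_dart D hxD haD
  rw [← (hG.eq_of_adj_of_mem_support P hP e.adj h1 h2).1]
  exact hp _ (p.dart_fst_mem_support_of_mem_darts he)

/-- Sets of weight at least `ε` that are connected in a tree have a cover with at most
`w(V) / ε` vertices. -/
theorem SimpleGraph.IsTree.exists_cover_card_mul_le {V : Type*} [Fintype V] {G : SimpleGraph V}
    (hG : G.IsTree) (w : V → ℝ) (hw : ∀ v, 0 ≤ w v) (ε : ℝ) (F : Finset (Finset V))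
    (hne : ∀ t ∈ F, t.Nonempty)
    (hconn : ∀ t ∈ F, ∀ x ∈ t, ∀ y ∈ t, ∃ p : G.Walk x y, ∀ v ∈ p.support, v ∈ t)
    (hε : ∀ t ∈ F, ε ≤ ∑ v ∈ t, w v) :
    ∃ C : Finset V, (C.card : ℝ) * ε ≤ ∑ v, w v ∧ ∀ t ∈ F, ∃ v ∈ C, v ∈ t := by
  classical
  obtain ⟨r⟩ := hG.connected.nonempty
  choose P hP using fun y => (hG.connected.preconnected y r).exists_isPath
  have hex : ∀ t : Finset V, ∃ b, t.Nonempty → b ∈ t ∧ ∀ y ∈ t, (P b).length ≤ (P y).length := by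
    intro t
    by_cases h : t.Nonempty
    · obtain ⟨b, hb⟩ := t.exists_min_image (fun y => (P y).length) h
      exact ⟨b, fun _ => hb⟩
    · exact ⟨r, fun h' => absurd h' h⟩
  choose top htop using hex
  obtain ⟨C, hC, hcov⟩ := exists_cover_card_mul_le_sum w hw ε top (fun y => (P y).length) F
    (fun t ht => (htop t (hne t ht)).1)
    (fun s hs t ht hst hle => by
      obtain ⟨x, hxs, hxt⟩ := not_disjoint_iff.1 hst
      exact hG.isAcyclic.top_mem_of_inter P hP (s := s) (t := t) (hconn s hs) (hconn t ht)
        (htop s (hne s hs)).1 (htop t (hne t ht)).1 hxs hxt (htop t (hne t ht)).2 hle) hε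
  exact ⟨C, hC.trans (sum_le_sum_of_subset_of_nonneg (subset_univ _) fun v _ _ => hw v), hcov⟩

/-- Some connected component of an induced subgraph with at most `d` components carries at least
a `1 / d` share of the weight. -/
theorem exists_connected_subset_one_div_le_sum {V : Type*} [Fintype V] (G : SimpleGraph V) (d : ℕ)
    (w : V → ℝ) (h : Set V) (hcomp : Nat.card (G.induce h).ConnectedComponent ≤ d)
    (hw : 1 ≤ ∑ v, Set.indicator h w v) :
    ∃ t : Finset V, t.Nonempty ∧ (t : Set V) ⊆ h ∧
      (∀ x ∈ t, ∀ y ∈ t, ∃ p : G.Walk x y, ∀ v ∈ p.support, v ∈ t) ∧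
      1 / (d : ℝ) ≤ ∑ v ∈ t, w v := by
  classical
  have hsum : ∑ v, Set.indicator h w v =
      ∑ c : (G.induce h).ConnectedComponent, ∑ v : h with
        (G.induce h).connectedComponentMk v = c, w v := by
    trans ∑ v : h, w v
    · refine (sum_indicator_eq_sum_filter univ (fun _ => w) (fun _ => h) id).trans ?_
      exact sum_subtype _ (by simp) w
    · convert (sum_fiberwise univ (G.induce h).connectedComponentMk fun v : h => w v).symm
  have hnonempty : Nonempty (G.induce h).ConnectedComponent := by
    by_contra hempty
    rw [not_nonempty_iff] at hempty
    rw [hsum, univ_eq_empty, sum_empty] at hw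
    linarith
  have hcard : (0 : ℝ) < Fintype.card (G.induce h).ConnectedComponent := by
    exact_mod_cast Fintype.card_pos
  rw [Nat.card_eq_fintype_card] at hcomp
  have hle : (Fintype.card (G.induce h).ConnectedComponent : ℝ) ≤ d := by exact_mod_cast hcomp
  obtain ⟨c, -, hc⟩ := exists_le_of_sum_le (s := univ)
    (f := fun _ : (G.induce h).ConnectedComponent => 1 / (d : ℝ))
    (g := fun c => ∑ v : h with (G.induce h).connectedComponentMk v = c, w v) univ_nonempty (by
      rw [hsum] at hw
      refine le_trans ?_ hw
      rw [sum_const, card_univ, nsmul_eq_mul, mul_one_div]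
      exact (div_le_one (hcard.trans_le hle)).2 hle)
  refine ⟨({v : h | (G.induce h).connectedComponentMk v = c} : Finset h).map
    (Function.Embedding.subtype _), ?_, ?_, ?_, ?_⟩
  · obtain ⟨v, hv⟩ := c.exists_rep
    exact Finset.Nonempty.map ⟨v, mem_filter.2 ⟨mem_univ _, hv⟩⟩
  · intro v hv
    simp only [coe_map, Set.mem_image] at hv
    obtain ⟨u, -, rfl⟩ := hv
    exact u.2
  · simp only [mem_map, mem_filter, mem_univ, true_and]
    rintro _ ⟨x, hx, rfl⟩ _ ⟨y, hy, rfl⟩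
    obtain ⟨p⟩ := SimpleGraph.ConnectedComponent.exact (hx.trans hy.symm)
    refine ⟨p.map (SimpleGraph.Embedding.induce h).toHom, fun v hv => ?_⟩
    obtain ⟨u, hu, rfl⟩ := List.mem_map.1 ((SimpleGraph.Walk.support_map _ p) ▸ hv)
    refine ⟨u, ?_, rfl⟩
    rw [← hx]
    exact SimpleGraph.ConnectedComponent.sound (p.takeUntil u hu).reachable.symm
  · rw [sum_map]
    exact hc

theorem tree_cover_le_d_mul_fracCover {V : Type*} [Fintype V]
    (G : SimpleGraph V) (hG : G.IsTree)
    (d : ℕ) (hd : 1 ≤ d)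
    (H : Finset (Set V)) (hne : ∀ h ∈ H, h.Nonempty)
    (hcomp : ∀ h ∈ H, Nat.card (G.induce h).ConnectedComponent ≤ d) :
    (vertexCoverNum H : ℝ) ≤ (d : ℝ) * vertexFracCoverNum H := by
  classical
  have hd0 : (0 : ℝ) < d := by exact_mod_cast hd
  rw [← div_le_iff₀' hd0]
  refine le_csInf ⟨_, fun _ => 1, fun _ => zero_le_one, fun h hh => ?_, rfl⟩ ?_
  · obtain ⟨x, hx⟩ := hne h hh
    calc (1 : ℝ) = h.indicator (fun _ => 1) x := by simp [hx]
      _ ≤ _ := single_le_sum (f := h.indicator fun _ => (1 : ℝ))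
        (fun v _ => Set.indicator_nonneg (fun _ _ => zero_le_one) v) (mem_univ x)
  · rintro _ ⟨w, hw, hcov, rfl⟩
    have key := fun h : H =>
      exists_connected_subset_one_div_le_sum G d w h (hcomp h h.2) (hcov h h.2)
    choose T hTne hTsub hTconn hTw using key
    obtain ⟨C, hC, hCcov⟩ := hG.exists_cover_card_mul_le w hw (1 / d) (univ.image T)
      (fun t ht => by
        obtain ⟨h, -, rfl⟩ := mem_image.1 ht
        exact hTne h)
      (fun t ht => by
        obtain ⟨h, -, rfl⟩ := mem_image.1 ht
        exact hTconn h)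
      (fun t ht => by
        obtain ⟨h, -, rfl⟩ := mem_image.1 ht
        exact hTw h)
    have hle : vertexCoverNum H ≤ C.card := Nat.sInf_le ⟨C, rfl, fun h hh => by
      obtain ⟨v, hv, hvt⟩ := hCcov (T ⟨h, hh⟩) (mem_image_of_mem _ (mem_univ _))
      exact ⟨v, hv, hTsub ⟨h, hh⟩ hvt⟩⟩
    rw [mul_one_div] at hC
    refine le_trans ?_ hC
    gcongr
end
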